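/- Long-time convergence, discounted case: let m > 2, λ > 0, f ∈ C(Ω̄), u₀ ∈ C(Ω̄) and g ∈ C(∂Ω) with u₀ = g on ∂Ω, and let u be the unique continuous viscosity solution of E(Ω,f,g,u₀,λ). Then u is uniformly bounded on Ω̄ × [0,+∞), and u(·,t) converges uniformly on Ω̄, as t → +∞, to u₁, the unique bounded continuous viscosity solution of the generalized Dirichlet problem S(Ω,f,g,λ). -/

import Mathlib

open Set Filter Topology Metric MeasureTheory

noncomputable section

/-- Euclidean space `ℝ^N`. -/
abbrev Euc (N : ℕ) : Type := EuclideanSpace ℝ (Fin N)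

/-- The Laplacian of `φ` at `x`, computed as the trace of the second derivative
in the standard orthonormal basis of `ℝ^N`. -/
noncomputable def lapl {N : ℕ} (φ : Euc N → ℝ) (x : Euc N) : ℝ :=
  ∑ i : Fin N,
    iteratedFDeriv ℝ 2 φ x ![EuclideanSpace.single i 1, EuclideanSpace.single i 1]

/-- `Ω` is a domain with `C²` boundary: it is the sublevel set of a `C²`
defining function whose gradient does not vanish on the boundary. -/
def HasC2Boundary {N : ℕ} (Ω : Set (Euc N)) : Prop :=
  ∃ ρ : Euc N → ℝ, ContDiff ℝ 2 ρ ∧ Ω = {x | ρ x < 0} ∧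
    frontier Ω = {x | ρ x = 0} ∧ ∀ x ∈ frontier Ω, gradient ρ x ≠ 0

/-- The stationary operator `−Δφ(x) + |Dφ(x)|^m + λ r − h(x)` evaluated with the
value `r` of the (sub/super)solution at `x`. -/
noncomputable def statOp {N : ℕ} (h : Euc N → ℝ) (lam m : ℝ)
    (φ : Euc N → ℝ) (r : ℝ) (x : Euc N) : ℝ :=
  -lapl φ x + ‖gradient φ x‖ ^ m + lam * r - h x

/-- Viscosity subsolution of the generalized Dirichlet problem
`S(Ω,h,k,λ)`: `−Δw + |Dw|^m + λ w = h` in `Ω`, `w = k` on `∂Ω`. -/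
def IsStatSub {N : ℕ} (Ω : Set (Euc N)) (h k : Euc N → ℝ) (lam m : ℝ)
    (u : Euc N → ℝ) : Prop :=
  UpperSemicontinuousOn u (closure Ω) ∧
  ∀ φ : Euc N → ℝ, ContDiff ℝ 2 φ → ∀ x₀ ∈ closure Ω,
    IsLocalMaxOn (u - φ) (closure Ω) x₀ →
      (x₀ ∈ Ω → statOp h lam m φ (u x₀) x₀ ≤ 0) ∧
      (x₀ ∈ frontier Ω → min (statOp h lam m φ (u x₀) x₀) (u x₀ - k x₀) ≤ 0)

/-- Viscosity supersolution of the generalized Dirichlet problem `S(Ω,h,k,λ)`. -/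
def IsStatSuper {N : ℕ} (Ω : Set (Euc N)) (h k : Euc N → ℝ) (lam m : ℝ)
    (v : Euc N → ℝ) : Prop :=
  LowerSemicontinuousOn v (closure Ω) ∧
  ∀ φ : Euc N → ℝ, ContDiff ℝ 2 φ → ∀ x₀ ∈ closure Ω,
    IsLocalMinOn (v - φ) (closure Ω) x₀ →
      (x₀ ∈ Ω → 0 ≤ statOp h lam m φ (v x₀) x₀) ∧
      (x₀ ∈ frontier Ω → 0 ≤ max (statOp h lam m φ (v x₀) x₀) (v x₀ - k x₀))

/-- The parabolic operator
`φ_t(x,t) − Δφ(·,t)(x) + |Dφ(·,t)(x)|^m + λ r − f(x)`. -/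
noncomputable def parOp {N : ℕ} (f : Euc N → ℝ) (lam m : ℝ)
    (φ : Euc N × ℝ → ℝ) (r : ℝ) (x : Euc N) (t : ℝ) : ℝ :=
  deriv (fun s => φ (x, s)) t - lapl (fun y => φ (y, t)) x
    + ‖gradient (fun y => φ (y, t)) x‖ ^ m + lam * r - f x

/-- Viscosity subsolution of the generalized initial-boundary value problem
`E(Ω,f,g,u₀,λ)` on the time interval `[0,T]`:
`u_t − Δu + |Du|^m + λ u = f` in `Ω × (0,T]`, `u = g` on `∂Ω × (0,T]`,
`u(·,0) = u₀` on `closure Ω`. -/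
def IsParSub {N : ℕ} (Ω : Set (Euc N)) (f g u₀ : Euc N → ℝ) (lam m T : ℝ)
    (u : Euc N → ℝ → ℝ) : Prop :=
  UpperSemicontinuousOn (fun p : Euc N × ℝ => u p.1 p.2) (closure Ω ×ˢ Ico 0 T) ∧
  (∀ x ∈ closure Ω, u x 0 ≤ u₀ x) ∧
  ∀ φ : Euc N × ℝ → ℝ, ContDiff ℝ 2 φ → ∀ x₀ : Euc N, ∀ t₀ : ℝ,
    (x₀, t₀) ∈ closure Ω ×ˢ Ioc 0 T →
    IsLocalMaxOn (fun p : Euc N × ℝ => u p.1 p.2 - φ p) (closure Ω ×ˢ Ioc 0 T) (x₀, t₀) →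
      (x₀ ∈ Ω → parOp f lam m φ (u x₀ t₀) x₀ t₀ ≤ 0) ∧
      (x₀ ∈ frontier Ω →
        min (parOp f lam m φ (u x₀ t₀) x₀ t₀) (u x₀ t₀ - g x₀) ≤ 0)

/-- Viscosity supersolution of `E(Ω,f,g,u₀,λ)` on the time interval `[0,T]`. -/
def IsParSuper {N : ℕ} (Ω : Set (Euc N)) (f g u₀ : Euc N → ℝ) (lam m T : ℝ)
    (v : Euc N → ℝ → ℝ) : Prop :=
  LowerSemicontinuousOn (fun p : Euc N × ℝ => v p.1 p.2) (closure Ω ×ˢ Icc 0 T) ∧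
  (∀ x ∈ closure Ω, u₀ x ≤ v x 0) ∧
  ∀ φ : Euc N × ℝ → ℝ, ContDiff ℝ 2 φ → ∀ x₀ : Euc N, ∀ t₀ : ℝ,
    (x₀, t₀) ∈ closure Ω ×ˢ Ioc 0 T →
    IsLocalMinOn (fun p : Euc N × ℝ => v p.1 p.2 - φ p) (closure Ω ×ˢ Ioc 0 T) (x₀, t₀) →
      (x₀ ∈ Ω → 0 ≤ parOp f lam m φ (v x₀ t₀) x₀ t₀) ∧
      (x₀ ∈ frontier Ω →
        0 ≤ max (parOp f lam m φ (v x₀ t₀) x₀ t₀) (v x₀ t₀ - g x₀))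

/-- A continuous viscosity solution, global in time, of `E(Ω,f,g,u₀,λ)`. -/
def IsGlobalParSol {N : ℕ} (Ω : Set (Euc N)) (f g u₀ : Euc N → ℝ) (lam m : ℝ)
    (u : Euc N → ℝ → ℝ) : Prop :=
  ContinuousOn (fun p : Euc N × ℝ => u p.1 p.2) (closure Ω ×ˢ Ici 0) ∧
  ∀ T > (0 : ℝ), IsParSub Ω f g u₀ lam m T u ∧ IsParSuper Ω f g u₀ lam m T u

open scoped Classical in
/-- Redefinition of a parabolic subsolution on the lateral boundary by its
`limsup` from inside `Ω × (0,T]`. -/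
noncomputable def uscExtPar {N : ℕ} (Ω : Set (Euc N)) (T : ℝ)
    (u : Euc N → ℝ → ℝ) : Euc N → ℝ → ℝ :=
  fun z t => if z ∈ Ω then u z t
    else limsup (fun p : Euc N × ℝ => u p.1 p.2) (𝓝[Ω ×ˢ Ioc 0 T] (z, t))

open scoped Classical in
/-- Redefinition of a stationary subsolution on the boundary by its `limsup`
from inside `Ω`. -/
noncomputable def uscExtStat {N : ℕ} (Ω : Set (Euc N))
    (u : Euc N → ℝ) : Euc N → ℝ :=
  fun z => if z ∈ Ω then u z else limsup u (𝓝[Ω] z)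

/-- Continuous viscosity solution of the state constraint problem
`−Δw + |Dw|^m + λ w = h` in `Ω`, `−Δw + |Dw|^m + λ w ≥ h` on `∂Ω`. -/
def IsSCSolution {N : ℕ} (Ω : Set (Euc N)) (h : Euc N → ℝ) (lam m : ℝ)
    (w : Euc N → ℝ) : Prop :=
  ContinuousOn w (closure Ω) ∧
  (∀ φ : Euc N → ℝ, ContDiff ℝ 2 φ → ∀ x₀ ∈ Ω, IsLocalMaxOn (w - φ) Ω x₀ →
      statOp h lam m φ (w x₀) x₀ ≤ 0) ∧
  (∀ φ : Euc N → ℝ, ContDiff ℝ 2 φ → ∀ x₀ ∈ closure Ω,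
      IsLocalMinOn (w - φ) (closure Ω) x₀ → 0 ≤ statOp h lam m φ (w x₀) x₀)

/-- Continuous viscosity subsolution of `−Δu + |Du|^m ≤ h` in `Ω`
(no boundary condition). -/
def IsIntSub {N : ℕ} (Ω : Set (Euc N)) (h : Euc N → ℝ) (m : ℝ)
    (u : Euc N → ℝ) : Prop :=
  ∀ φ : Euc N → ℝ, ContDiff ℝ 2 φ → ∀ x₀ ∈ Ω, IsLocalMaxOn (u - φ) Ω x₀ →
    statOp h 0 m φ (u x₀) x₀ ≤ 0

/-- Hölder continuity with exponent `α` on a set. -/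
def HolderOnCl {N : ℕ} (α : ℝ) (s : Set (Euc N)) (w : Euc N → ℝ) : Prop :=
  ∃ C > (0 : ℝ), ∀ x ∈ s, ∀ y ∈ s, |w x - w y| ≤ C * ‖x - y‖ ^ α

/-- Local Lipschitz continuity inside `Ω`. -/
def LocLipIn {N : ℕ} (Ω : Set (Euc N)) (w : Euc N → ℝ) : Prop :=
  ∀ x ∈ Ω, ∃ ε > (0 : ℝ), ∃ K : ℝ, 0 ≤ K ∧
    ∀ y ∈ ball x ε ∩ Ω, ∀ z ∈ ball x ε ∩ Ω, |w y - w z| ≤ K * ‖y - z‖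

/-- A piecewise `C¹` path parametrized on `[0,1]`. -/
def IsPWC1Path {N : ℕ} (γ : ℝ → Euc N) : Prop :=
  ContinuousOn γ (Icc 0 1) ∧
  ∃ n : ℕ, ∃ τ : Fin (n + 1) → ℝ, StrictMono τ ∧ τ 0 = 0 ∧ τ (Fin.last n) = 1 ∧
    ∀ i : Fin n, ContDiffOn ℝ 1 γ (Icc (τ i.castSucc) (τ i.succ))

/-- The length of a path on `[0,1]`. -/
noncomputable def pathLen {N : ℕ} (γ : ℝ → Euc N) : ℝ :=
  ∫ t in (0 : ℝ)..1, ‖derivWithin γ (Icc (0 : ℝ) 1) t‖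

/-- The geodesic-type distance inside `closure S` via piecewise `C¹` paths. -/
noncomputable def dTilde {N : ℕ} (S : Set (Euc N)) (x y : Euc N) : ℝ :=
  sInf {L : ℝ | ∃ γ : ℝ → Euc N, IsPWC1Path γ ∧ γ 0 = x ∧ γ 1 = y ∧
    MapsTo γ (Icc 0 1) (closure S) ∧ L = pathLen γ}

/-- The inner parallel set `Ω_δ = {x ∈ Ω : dist(x,∂Ω) > δ}`. -/
def innerSet {N : ℕ} (Ω : Set (Euc N)) (δ : ℝ) : Set (Euc N) :=
  {x ∈ Ω | δ < infDist x (frontier Ω)}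

end

section Laplacian

open Laplacian

variable {N : ℕ}

theorem lapl_eq_laplacian (φ : Euc N → ℝ) : lapl φ = Δ φ := by
  ext x
  rw [InnerProductSpace.laplacian_eq_iteratedFDeriv_orthonormalBasis φ
    (EuclideanSpace.basisFun (Fin N) ℝ)]
  simp [lapl]

theorem lapl_eq_sum_fderiv (φ : Euc N → ℝ) (x : Euc N) :
    lapl φ x = ∑ i : Fin N, fderiv ℝ (fderiv ℝ φ) x (EuclideanSpace.single i 1)
      (EuclideanSpace.single i 1) := by
  simp [lapl, iteratedFDeriv_two_apply]

theorem Filter.EventuallyEq.lapl_eq {φ ψ : Euc N → ℝ} {x : Euc N} (h : φ =ᶠ[𝓝 x] ψ) :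
    lapl φ x = lapl ψ x := by
  rw [lapl_eq_sum_fderiv, lapl_eq_sum_fderiv, h.fderiv.fderiv_eq]

theorem lapl_add {φ ψ : Euc N → ℝ} {x : Euc N} (hφ : ContDiffAt ℝ 2 φ x)
    (hψ : ContDiffAt ℝ 2 ψ x) : lapl (fun y => φ y + ψ y) x = lapl φ x + lapl ψ x := by
  rw [lapl_eq_laplacian, lapl_eq_laplacian, lapl_eq_laplacian]
  exact hφ.laplacian_add hψ

theorem lapl_const_mul {φ : Euc N → ℝ} {x : Euc N} (c : ℝ) (hφ : ContDiffAt ℝ 2 φ x) :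
    lapl (fun y => c * φ y) x = c * lapl φ x := by
  rw [lapl_eq_laplacian, lapl_eq_laplacian]
  exact InnerProductSpace.laplacian_smul c hφ

theorem lapl_const (c : ℝ) (x : Euc N) : lapl (fun _ => c) x = 0 := by
  simp [lapl_eq_sum_fderiv]

theorem lapl_comp_add (φ : Euc N → ℝ) (a x : Euc N) :
    lapl (fun y => φ (y + a)) x = lapl φ (x + a) := by
  have h : fderiv ℝ (fun y => φ (y + a)) = fun y => fderiv ℝ φ (y + a) := by
    ext1 y
    exact fderiv_comp_add_right a
  rw [lapl_eq_sum_fderiv, lapl_eq_sum_fderiv, h, fderiv_comp_add_right]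

theorem gradient_comp_add (φ : Euc N → ℝ) (a x : Euc N) :
    gradient (fun y => φ (y + a)) x = gradient φ (x + a) := by
  simp only [gradient]
  rw [fderiv_comp_add_right]

theorem ContDiff.continuous_lapl {φ : Euc N → ℝ} (hφ : ContDiff ℝ 2 φ) :
    Continuous (lapl φ) := by
  have h : ContDiff ℝ 1 (fderiv ℝ φ) := hφ.fderiv_right (by norm_num)
  have h2 : Continuous (fderiv ℝ (fderiv ℝ φ)) := h.continuous_fderiv (by norm_num)
  have : lapl φ = fun x => ∑ i : Fin N, fderiv ℝ (fderiv ℝ φ) x (EuclideanSpace.single i 1)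
      (EuclideanSpace.single i 1) := by
    ext x; exact lapl_eq_sum_fderiv φ x
  rw [this]
  fun_prop

theorem ContDiff.continuous_gradient {φ : Euc N → ℝ} (hφ : ContDiff ℝ 2 φ) :
    Continuous (gradient φ) := by
  have h2 : Continuous (fderiv ℝ φ) := hφ.continuous_fderiv (by norm_num)
  exact (InnerProductSpace.toDual ℝ (Euc N)).symm.continuous.comp h2

theorem gradient_add' {φ ψ : Euc N → ℝ} {x : Euc N} (hφ : DifferentiableAt ℝ φ x)
    (hψ : DifferentiableAt ℝ ψ x) :
    gradient (fun y => φ y + ψ y) x = gradient φ x + gradient ψ x := by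
  simp only [gradient]
  rw [fderiv_fun_add hφ hψ, map_add]

theorem gradient_const_mul' {φ : Euc N → ℝ} {x : Euc N} (c : ℝ) (hφ : DifferentiableAt ℝ φ x) :
    gradient (fun y => c * φ y) x = c • gradient φ x := by
  simp only [gradient]
  rw [fderiv_const_mul hφ, map_smulₛₗ]
  simp

/-- Laplacian from a gradient field and its derivative. -/
theorem lapl_of_hasGradientAt {φ : Euc N → ℝ} {G : Euc N → Euc N} {A : Euc N →L[ℝ] Euc N}
    {x : Euc N} (hG : ∀ y, HasGradientAt φ (G y) y) (hA : HasFDerivAt G A x) :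
    lapl φ x = ∑ i : Fin N, A (EuclideanSpace.single i 1) i := by
  have h : fderiv ℝ φ = fun y => InnerProductSpace.toDual ℝ (Euc N) (G y) := by
    ext1 y
    exact (hG y).hasFDerivAt.fderiv
  have h2 : HasFDerivAt (fderiv ℝ φ)
      ((InnerProductSpace.toDual ℝ (Euc N)).toContinuousLinearEquiv.toContinuousLinearMap.comp A)
      x := by
    rw [h]
    exact (InnerProductSpace.toDual ℝ (Euc N)).toContinuousLinearEquiv.toContinuousLinearMap.hasFDerivAt.comp x hA
  rw [lapl_eq_sum_fderiv, h2.fderiv]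
  refine Finset.sum_congr rfl fun i _ => ?_
  simp [EuclideanSpace.inner_single_right]

/-- Gradient of a radial function `F (‖x‖²)`. -/
theorem hasGradientAt_radial {F F' : ℝ → ℝ} (hF : ∀ s, HasDerivAt F (F' s) s) (x : Euc N) :
    HasGradientAt (fun y : Euc N => F (‖y‖ ^ 2)) ((2 * F' (‖x‖ ^ 2)) • x) x := by
  rw [hasGradientAt_iff_hasFDerivAt]
  have h := (hF (‖x‖ ^ 2)).comp_hasFDerivAt x (hasStrictFDerivAt_norm_sq x).hasFDerivAt
  convert! h using 1
  ext v
  simp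
  ring

/-- Laplacian of a radial function `F (‖x‖²)`. -/
theorem lapl_radial {F F' F'' : ℝ → ℝ} (hF : ∀ s, HasDerivAt F (F' s) s)
    (hF' : ∀ s, HasDerivAt F' (F'' s) s) (x : Euc N) :
    lapl (fun y : Euc N => F (‖y‖ ^ 2)) x
      = 4 * ‖x‖ ^ 2 * F'' (‖x‖ ^ 2) + 2 * N * F' (‖x‖ ^ 2) := by
  have h1 : HasFDerivAt (fun y : Euc N => 2 * F' (‖y‖ ^ 2)) _ x :=
    (((hF' (‖x‖ ^ 2)).comp_hasFDerivAt x
      (hasStrictFDerivAt_norm_sq x).hasFDerivAt)).const_mul 2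
  rw [lapl_of_hasGradientAt (hasGradientAt_radial hF) (h1.smul (hasFDerivAt_id x))]
  simp [Finset.sum_add_distrib, EuclideanSpace.inner_single_right, EuclideanSpace.norm_sq_eq]
  simp_rw [Finset.mul_sum, Finset.sum_mul]
  rw [add_comm]
  congr 1
  · exact Finset.sum_congr rfl fun i _ => by ring
  · ring

end Laplacian

section Jets

variable {N : ℕ}

/-- `φ` is `C²` at `(x,t)` with time derivative `a`, space gradient `p` and
space Laplacian `l` there. -/
def HasJet (φ : Euc N × ℝ → ℝ) (x : Euc N) (t a : ℝ) (p : Euc N) (l : ℝ) : Prop :=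
  ContDiffAt ℝ 2 φ (x, t) ∧ deriv (fun s => φ (x, s)) t = a ∧
    gradient (fun y => φ (y, t)) x = p ∧ lapl (fun y => φ (y, t)) x = l

theorem ContDiffAt.slice_fst {φ : Euc N × ℝ → ℝ} {x : Euc N} {t : ℝ} {n : WithTop ℕ∞}
    (h : ContDiffAt ℝ n φ (x, t)) : ContDiffAt ℝ n (fun y => φ (y, t)) x :=
  ContDiffAt.comp x h (contDiffAt_id.prodMk contDiffAt_const)

theorem ContDiffAt.slice_snd {φ : Euc N × ℝ → ℝ} {x : Euc N} {t : ℝ} {n : WithTop ℕ∞}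
    (h : ContDiffAt ℝ n φ (x, t)) : ContDiffAt ℝ n (fun s => φ (x, s)) t :=
  ContDiffAt.comp t h (contDiffAt_const.prodMk contDiffAt_id)

theorem ContDiffAt.hasJet {φ : Euc N × ℝ → ℝ} {x : Euc N} {t : ℝ}
    (h : ContDiffAt ℝ 2 φ (x, t)) :
    HasJet φ x t (deriv (fun s => φ (x, s)) t) (gradient (fun y => φ (y, t)) x)
      (lapl (fun y => φ (y, t)) x) := ⟨h, rfl, rfl, rfl⟩

namespace HasJet

variable {φ ψ : Euc N × ℝ → ℝ} {x : Euc N} {t a b : ℝ} {p q : Euc N} {l k : ℝ}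

theorem differentiableAt_fst (h : HasJet φ x t a p l) :
    DifferentiableAt ℝ (fun y => φ (y, t)) x := h.1.slice_fst.differentiableAt (by norm_num)

theorem differentiableAt_snd (h : HasJet φ x t a p l) :
    DifferentiableAt ℝ (fun s => φ (x, s)) t := h.1.slice_snd.differentiableAt (by norm_num)

theorem add (hφ : HasJet φ x t a p l) (hψ : HasJet ψ x t b q k) :
    HasJet (fun X => φ X + ψ X) x t (a + b) (p + q) (l + k) := by
  refine ⟨hφ.1.add hψ.1, ?_, ?_, ?_⟩
  · rw [deriv_fun_add hφ.differentiableAt_snd hψ.differentiableAt_snd, hφ.2.1, hψ.2.1]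
  · rw [gradient_add' hφ.differentiableAt_fst hψ.differentiableAt_fst, hφ.2.2.1, hψ.2.2.1]
  · rw [lapl_add hφ.1.slice_fst hψ.1.slice_fst, hφ.2.2.2, hψ.2.2.2]

theorem const_mul (c : ℝ) (hφ : HasJet φ x t a p l) :
    HasJet (fun X => c * φ X) x t (c * a) (c • p) (c * l) := by
  refine ⟨contDiffAt_const.mul hφ.1, ?_, ?_, ?_⟩
  · rw [deriv_const_mul c hφ.differentiableAt_snd, hφ.2.1]
  · rw [gradient_const_mul' c hφ.differentiableAt_fst, hφ.2.2.1]
  · rw [lapl_const_mul c hφ.1.slice_fst, hφ.2.2.2]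

theorem neg (hφ : HasJet φ x t a p l) : HasJet (fun X => - φ X) x t (-a) (-p) (-l) := by
  simpa using hφ.const_mul (-1)

theorem congr_of_eventuallyEq (hφ : HasJet φ x t a p l) (h : ψ =ᶠ[𝓝 (x, t)] φ) :
    HasJet ψ x t a p l := by
  have h1 : (fun y => ψ (y, t)) =ᶠ[𝓝 x] fun y => φ (y, t) :=
    (Continuous.prodMk_left t).continuousAt.eventually h
  have h2 : (fun s => ψ (x, s)) =ᶠ[𝓝 t] fun s => φ (x, s) :=
    (Continuous.prodMk_right x).continuousAt.eventually h
  refine ⟨hφ.1.congr_of_eventuallyEq h, ?_, ?_, ?_⟩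
  · rw [h2.deriv_eq, hφ.2.1]
  · rw [h1.gradient_eq, hφ.2.2.1]
  · rw [h1.lapl_eq, hφ.2.2.2]

theorem congr_val (hφ : HasJet φ x t a p l) (ha : a = b) (hp : p = q) (hl : l = k) :
    HasJet φ x t b q k := by
  subst ha hp hl; exact hφ

/-- Jet of a product of a function of space and a function of time. -/
theorem fst_mul_snd {h : Euc N → ℝ} {θ : ℝ → ℝ} (hh : ContDiffAt ℝ 2 h x)
    (hθ : ContDiffAt ℝ 2 θ t) :
    HasJet (fun X : Euc N × ℝ => h X.1 * θ X.2) x t (h x * deriv θ t) (θ t • gradient h x)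
      (θ t * lapl h x) := by
  refine ⟨(ContDiffAt.comp (x, t) hh contDiffAt_fst).mul
    (ContDiffAt.comp (x, t) hθ contDiffAt_snd), ?_, ?_, ?_⟩
  · exact deriv_const_mul (h x) (hθ.differentiableAt (by norm_num))
  · simp_rw [mul_comm (h _)]
    exact gradient_const_mul' _ (hh.differentiableAt (by norm_num))
  · simp_rw [mul_comm (h _)]
    exact lapl_const_mul _ hh

theorem of_fst {h : Euc N → ℝ} (hh : ContDiffAt ℝ 2 h x) :
    HasJet (fun X : Euc N × ℝ => h X.1) x t 0 (gradient h x) (lapl h x) := by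
  simpa using fst_mul_snd (t := t) (θ := fun _ => 1) hh contDiffAt_const

theorem of_snd {θ : ℝ → ℝ} (hθ : ContDiffAt ℝ 2 θ t) :
    HasJet (fun X : Euc N × ℝ => θ X.2) x t (deriv θ t) 0 0 := by
  have := fst_mul_snd (x := x) (h := fun _ => 1) contDiffAt_const hθ
  simpa [lapl_const, gradient_fun_const] using this

/-- Behaviour of jets under the Galilean change of variables `x ↦ x - (t - t₁) q`. -/
theorem comp_shear {t₁ : ℝ} {q : Euc N}
    (hφ : HasJet φ (x - (t - t₁) • q) (t - t₁) a p l) :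
    HasJet (fun X : Euc N × ℝ => φ (X.1 - (X.2 - t₁) • q, X.2 - t₁)) x t
      (a - inner ℝ q p) p l := by
  refine ⟨?_, ?_, ?_, ?_⟩
  · refine ContDiffAt.comp (x, t) (g := φ)
      (f := fun X : Euc N × ℝ => (X.1 - (X.2 - t₁) • q, X.2 - t₁)) hφ.1 ?_
    exact ContDiff.contDiffAt (by fun_prop)
  · have hd : DifferentiableAt ℝ φ (x - (t - t₁) • q, t - t₁) :=
      hφ.1.differentiableAt (by norm_num)
    have h1 : HasDerivAt (fun s : ℝ => (x - (s - t₁) • q, s - t₁)) (-q, (1 : ℝ)) t := by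
      have e1 : HasDerivAt (fun s : ℝ => s - t₁) 1 t := (hasDerivAt_id t).sub_const t₁
      have e2 : HasDerivAt (fun s : ℝ => x - (s - t₁) • q) (-q) t := by
        simpa using (e1.smul_const q).const_sub x
      exact e2.prodMk e1
    have h2 := hd.hasFDerivAt.comp_hasDerivAt t h1
    have h3 : HasDerivAt (fun s => φ (x - (t - t₁) • q, s))
        (fderiv ℝ φ (x - (t - t₁) • q, t - t₁) (0, 1)) (t - t₁) :=
      HasFDerivAt.comp_hasDerivAt (l := φ) (t - t₁) hd.hasFDerivAt
        ((hasDerivAt_const _ _).prodMk (hasDerivAt_id _))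
    have h4 : HasFDerivAt (fun y => φ (y, t - t₁))
        ((fderiv ℝ φ (x - (t - t₁) • q, t - t₁)).comp
          ((ContinuousLinearMap.id ℝ (Euc N)).prod 0)) (x - (t - t₁) • q) :=
      HasFDerivAt.comp (g := φ) _ hd.hasFDerivAt
        ((hasFDerivAt_id _).prodMk (hasFDerivAt_const _ _))
    have h5 : inner ℝ q p = fderiv ℝ φ (x - (t - t₁) • q, t - t₁) (q, 0) := by
      rw [← hφ.2.2.1, inner_gradient_right, h4.fderiv]
      simp
    have h6 : ((-q, (1 : ℝ)) : Euc N × ℝ) = (0, 1) - (q, 0) := by simp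
    rw [h5, ← hφ.2.1, h3.deriv, ← map_sub, ← h6]
    exact h2.deriv
  · have := gradient_comp_add (fun y => φ (y, t - t₁)) (-((t - t₁) • q)) x
    simpa [← sub_eq_add_neg, hφ.2.2.1] using this
  · have := lapl_comp_add (fun y => φ (y, t - t₁)) (-((t - t₁) • q)) x
    simpa [← sub_eq_add_neg, hφ.2.2.2] using this

/-- Behaviour of jets under translations. -/
theorem comp_sub {y : Euc N} {s : ℝ} (hφ : HasJet φ (x - y) (t - s) a p l) :
    HasJet (fun X : Euc N × ℝ => φ (X.1 - y, X.2 - s)) x t a p l := by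
  refine ⟨?_, ?_, ?_, ?_⟩
  · refine ContDiffAt.comp (x, t) (g := φ)
      (f := fun X : Euc N × ℝ => (X.1 - y, X.2 - s)) hφ.1 ?_
    exact ContDiff.contDiffAt (by fun_prop)
  · rw [← hφ.2.1]
    exact deriv_comp_sub_const (f := fun r => φ (x - y, r)) s t
  · have := gradient_comp_add (fun z => φ (z, t - s)) (-y) x
    simpa [← sub_eq_add_neg, hφ.2.2.1] using this
  · have := lapl_comp_add (fun z => φ (z, t - s)) (-y) x
    simpa [← sub_eq_add_neg, hφ.2.2.2] using this

/-- A function with a jet at a point coincides near this point with a `C²` function. -/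
theorem exists_contDiff (hφ : HasJet φ x t a p l) :
    ∃ ψ : Euc N × ℝ → ℝ, ContDiff ℝ 2 ψ ∧ ψ =ᶠ[𝓝 (x, t)] φ := by
  obtain ⟨U, hU, hφU⟩ := hφ.1.contDiffOn le_rfl (by simp)
  obtain ⟨r, hr, hrU⟩ := Metric.nhds_basis_closedBall.mem_iff.1 hU
  let χ : ContDiffBump (x, t) := ⟨r / 4, r / 2, by positivity, by linarith⟩
  refine ⟨fun X => χ X * φ X, ?_, ?_⟩
  · rw [contDiff_iff_contDiffAt]
    intro X
    by_cases hX : X ∈ ball (x, t) r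
    · exact χ.contDiffAt.mul
        ((hφU.contDiffAt (Filter.mem_of_superset (isOpen_ball.mem_nhds hX)
          (ball_subset_closedBall.trans hrU))))
    · have : (fun X => χ X * φ X) =ᶠ[𝓝 X] fun _ => 0 := by
        have hc : X ∉ tsupport χ := by
          rw [χ.tsupport_eq]
          simp only [mem_ball, mem_closedBall, not_lt, not_le] at hX ⊢
          change r / 2 < _
          linarith
        filter_upwards [(isClosed_tsupport χ).isOpen_compl.mem_nhds hc] with Y hY
        simp [image_eq_zero_of_notMem_tsupport hY]
      exact contDiffAt_const.congr_of_eventuallyEq this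
  · filter_upwards [χ.eventuallyEq_one] with X hX
    simp [hX]

end HasJet

theorem contDiff_sq_norm_sub (x₀ : Euc N) : ContDiff ℝ 2 fun x : Euc N => ‖x - x₀‖ ^ 2 :=
  (contDiff_norm_sq ℝ).comp (contDiff_id.sub contDiff_const)

theorem gradient_sq_norm_sub (x₀ x : Euc N) :
    gradient (fun x : Euc N => ‖x - x₀‖ ^ 2) x = (2 : ℝ) • (x - x₀) := by
  have h := gradient_comp_add (fun y : Euc N => ‖y‖ ^ 2) (-x₀) x
  simp only [← sub_eq_add_neg] at h
  rw [h, (hasGradientAt_radial (F := fun s => s) (F' := fun _ => 1) (fun s => hasDerivAt_id s)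
    _).gradient]
  simp

theorem lapl_sq_norm_sub (x₀ x : Euc N) :
    lapl (fun x : Euc N => ‖x - x₀‖ ^ 2) x = 2 * N := by
  have h := lapl_comp_add (fun y : Euc N => ‖y‖ ^ 2) (-x₀) x
  simp only [← sub_eq_add_neg] at h
  rw [h, lapl_radial (F := fun s => s) (F' := fun _ => 1) (F'' := fun _ => 0)
    (fun s => hasDerivAt_id s) (fun s => hasDerivAt_const s 1)]
  simp

theorem contDiff_norm_sub_pow_four (x₀ : Euc N) :
    ContDiff ℝ 2 fun x : Euc N => (‖x - x₀‖ ^ 2) ^ 2 :=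
  (contDiff_sq_norm_sub x₀).pow 2

theorem gradient_norm_sub_pow_four (x₀ x : Euc N) :
    gradient (fun x : Euc N => (‖x - x₀‖ ^ 2) ^ 2) x = (4 * ‖x - x₀‖ ^ 2) • (x - x₀) := by
  have h := gradient_comp_add (fun y : Euc N => (‖y‖ ^ 2) ^ 2) (-x₀) x
  simp only [← sub_eq_add_neg] at h
  rw [h, (hasGradientAt_radial (F := fun s => s ^ 2) (F' := fun s => 2 * s)
    (fun s => by simpa using hasDerivAt_pow 2 s) _).gradient]
  congr 1; ring

theorem lapl_norm_sub_pow_four (x₀ x : Euc N) :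
    lapl (fun x : Euc N => (‖x - x₀‖ ^ 2) ^ 2) x = (4 * N + 8) * ‖x - x₀‖ ^ 2 := by
  have h := lapl_comp_add (fun y : Euc N => (‖y‖ ^ 2) ^ 2) (-x₀) x
  simp only [← sub_eq_add_neg] at h
  rw [h, lapl_radial (F := fun s => s ^ 2) (F' := fun s => 2 * s) (F'' := fun _ => 2)
    (fun s => by simpa using hasDerivAt_pow 2 s)
    (fun s => by simpa using (hasDerivAt_id s).const_mul 2)]
  ring

end Jets

section Heat

variable {N : ℕ}

/-- The unnormalized Gaussian weight. -/
noncomputable def gaussW (z : Euc N) : ℝ := Real.exp (-(‖z‖ ^ 2 / 4))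

theorem gaussW_pos (z : Euc N) : 0 < gaussW z := Real.exp_pos _

theorem contDiff_gaussW {n : WithTop ℕ∞} : ContDiff ℝ n (gaussW (N := N)) :=
  (((contDiff_norm_sq ℝ).div_const 4).neg).exp

theorem continuous_gaussW : Continuous (gaussW (N := N)) :=
  (contDiff_gaussW (n := 0)).continuous

theorem integrable_exp_neg_mul_sq_norm {b : ℝ} (hb : 0 < b) :
    Integrable fun z : Euc N => Real.exp (-(b * ‖z‖ ^ 2)) := by
  have h := (GaussianFourier.integrable_cexp_neg_mul_sq_norm_add (V := Euc N) (b := (b : ℂ))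
    (by simpa using hb) 0 0).re
  refine h.congr (Eventually.of_forall fun z => ?_)
  simp only [zero_mul, add_zero]
  rw [show (-(b : ℂ) * (‖z‖ : ℂ) ^ 2) = ((-(b * ‖z‖ ^ 2) : ℝ) : ℂ) by push_cast; ring]
  exact Complex.exp_ofReal_re _

theorem integrable_gaussW : Integrable (gaussW (N := N)) := by
  refine (integrable_exp_neg_mul_sq_norm (N := N) (b := 1 / 4) (by norm_num)).congr
    (Eventually.of_forall fun z => ?_)
  simp only [gaussW]; congr 1; ring

theorem integral_gaussW_pos : 0 < ∫ z : Euc N, gaussW z := by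
  rw [integral_pos_iff_support_of_nonneg (fun z => (gaussW_pos z).le) integrable_gaussW]
  have : Function.support (gaussW (N := N)) = univ := by
    ext z; simp [(gaussW_pos z).ne']
  rw [this]
  exact Measure.measure_univ_pos.2 (NeZero.ne _)

/-- The solution at time `τ` of the heat equation with initial datum `v`. -/
noncomputable def heat (v : Euc N → ℝ) (x : Euc N) (τ : ℝ) : ℝ :=
  (∫ z : Euc N, gaussW z)⁻¹ * ∫ z, gaussW z * v (x + √τ • z)

theorem heat_zero (v : Euc N → ℝ) (x : Euc N) : heat v x 0 = v x := by
  simp only [heat, Real.sqrt_zero, zero_smul, add_zero]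
  rw [integral_mul_const, ← mul_assoc, inv_mul_cancel₀ integral_gaussW_pos.ne', one_mul]

theorem abs_heat_le {v : Euc N → ℝ} {M : ℝ} (hv : ∀ x, |v x| ≤ M) (x : Euc N) (τ : ℝ) :
    |heat v x τ| ≤ M := by
  have h : |∫ z, gaussW z * v (x + √τ • z)| ≤ ∫ z : Euc N, gaussW z * M := by
    rw [← Real.norm_eq_abs]
    refine norm_integral_le_of_norm_le (integrable_gaussW.mul_const M)
      (Eventually.of_forall fun z => ?_)
    rw [norm_mul, Real.norm_of_nonneg (gaussW_pos z).le]
    exact mul_le_mul_of_nonneg_left (hv _) (gaussW_pos z).le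
  rw [integral_mul_const] at h
  rw [heat, abs_mul, abs_of_pos (inv_pos.2 integral_gaussW_pos), inv_mul_le_iff₀ integral_gaussW_pos]
  exact h

theorem continuous_integral_gaussW_mul {Y : Type*} [TopologicalSpace Y]
    [FirstCountableTopology Y] {G : Y → Euc N → ℝ} {M : ℝ}
    (hG : Continuous fun P : Y × Euc N => G P.1 P.2) (hM : ∀ y z, |G y z| ≤ M) :
    Continuous fun y => ∫ z, gaussW z * G y z := by
  refine continuous_of_dominated (bound := fun z => gaussW z * M) (fun y => ?_) (fun y => ?_)
    (integrable_gaussW.mul_const M) (Eventually.of_forall fun z => ?_)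
  · exact (continuous_gaussW.mul
      (hG.comp (Continuous.prodMk_right y))).aestronglyMeasurable
  · refine Eventually.of_forall fun z => ?_
    rw [norm_mul, Real.norm_of_nonneg (gaussW_pos z).le]
    exact mul_le_mul_of_nonneg_left (hM _ _) (gaussW_pos z).le
  · exact continuous_const.mul (hG.comp (Continuous.prodMk_left z))

theorem continuous_heat {v : Euc N → ℝ} {M : ℝ} (hc : Continuous v) (hv : ∀ x, |v x| ≤ M) :
    Continuous fun X : Euc N × ℝ => heat v X.1 X.2 := by
  refine continuous_const.mul (continuous_integral_gaussW_mul (M := M)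
    (G := fun (X : Euc N × ℝ) z => v (X.1 + √X.2 • z)) ?_ (fun _ _ => hv _))
  have := Real.continuous_sqrt
  fun_prop

/-- The (unnormalized) heat kernel. -/
noncomputable def heatKer (w : Euc N) (τ : ℝ) : ℝ :=
  τ ^ (-(N / 2 : ℝ)) * Real.exp (-(‖w‖ ^ 2 / (4 * τ)))

theorem contDiffOn_heatKer {n : WithTop ℕ∞} :
    ContDiffOn ℝ n (fun X : Euc N × ℝ => heatKer X.1 X.2) {X | 0 < X.2} := by
  intro X hX
  have hX' : X.2 ≠ 0 := ne_of_gt hX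
  refine ContDiffAt.contDiffWithinAt ?_
  refine ContDiffAt.mul (contDiffAt_snd.rpow_const_of_ne hX') (ContDiffAt.exp (ContDiffAt.neg ?_))
  exact (((contDiff_norm_sq ℝ).contDiffAt).comp X contDiffAt_fst).div
    (contDiffAt_const.mul contDiffAt_snd) (by positivity)

theorem hasDerivAt_heatKer_time (w : Euc N) {τ : ℝ} (hτ : 0 < τ) :
    HasDerivAt (fun r => heatKer w r)
      ((‖w‖ ^ 2 / (4 * τ ^ 2) - N / (2 * τ)) * heatKer w τ) τ := by
  have h1 : HasDerivAt (fun r : ℝ => r ^ (-(N / 2 : ℝ)))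
      (-(N / 2 : ℝ) * τ ^ (-(N / 2 : ℝ) - 1)) τ :=
    Real.hasDerivAt_rpow_const (Or.inl hτ.ne')
  have h2 : HasDerivAt (fun r : ℝ => -(‖w‖ ^ 2 / (4 * r))) (‖w‖ ^ 2 / (4 * τ ^ 2)) τ := by
    have := (((hasDerivAt_id τ).const_mul 4).inv (by simpa using hτ.ne')).const_mul (-‖w‖ ^ 2)
    refine (this.congr_deriv ?_).congr_of_eventuallyEq (Eventually.of_forall fun r => ?_)
    · simp only [id]; field_simp
    · simp only [id, Pi.inv_apply]; ring
  refine (h1.mul h2.exp).congr_deriv ?_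
  rw [Real.rpow_sub_one hτ.ne']
  simp only [heatKer]
  field_simp
  ring

theorem hasDerivAt_heatKer_space (w e : Euc N) {τ : ℝ} (hτ : 0 < τ) (s : ℝ) :
    HasDerivAt (fun r : ℝ => heatKer (w + r • e) τ)
      (-(inner ℝ (w + s • e) e / (2 * τ)) * heatKer (w + s • e) τ) s := by
  have h1 : HasDerivAt (fun r : ℝ => w + r • e) e s := by
    simpa using ((hasDerivAt_id s).smul_const e).const_add w
  have h2 := h1.norm_sq
  refine (((h2.div_const (4 * τ)).neg).exp.const_mul (τ ^ (-(N / 2 : ℝ)))).congr_deriv ?_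
  simp only [heatKer, Pi.neg_apply]
  field_simp
  ring

theorem hasDerivAt_heatKer_space_two (w e : Euc N) {τ : ℝ} (hτ : 0 < τ) (s : ℝ) :
    HasDerivAt (fun r : ℝ => -(inner ℝ (w + r • e) e / (2 * τ)) * heatKer (w + r • e) τ)
      ((inner ℝ (w + s • e) e ^ 2 / (4 * τ ^ 2) - ‖e‖ ^ 2 / (2 * τ)) * heatKer (w + s • e) τ)
      s := by
  have h1 : HasDerivAt (fun r : ℝ => w + r • e) e s := by
    simpa using ((hasDerivAt_id s).smul_const e).const_add w
  have h2 : HasDerivAt (fun r : ℝ => -(inner ℝ (w + r • e) e / (2 * τ)))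
      (-(‖e‖ ^ 2 / (2 * τ))) s := by
    have := h1.inner ℝ (hasDerivAt_const s e)
    simp only [inner_zero_right, zero_add, real_inner_self_eq_norm_sq] at this
    exact (this.div_const _).neg
  refine (h2.mul (hasDerivAt_heatKer_space w e hτ s)).congr_deriv ?_
  field_simp
  ring

/-- Differentiation of `∫ v(y) h(s,y) dy` in `s` for a compactly supported `v`. -/
theorem hasDerivAt_integral_mul_of_hasCompactSupport {v : Euc N → ℝ} (hv : Continuous v)
    (hvc : HasCompactSupport v) {h h' : ℝ → Euc N → ℝ} {s₀ δ : ℝ} (hδ : 0 < δ)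
    (hh : ∀ s ∈ closedBall s₀ δ, Continuous (h s))
    (hd : ∀ y, ∀ s ∈ closedBall s₀ δ, HasDerivAt (fun r => h r y) (h' s y) s)
    (hc : ContinuousOn (fun P : ℝ × Euc N => h' P.1 P.2) (closedBall s₀ δ ×ˢ univ)) :
    HasDerivAt (fun s => ∫ y, v y * h s y) (∫ y, v y * h' s₀ y) s₀ := by
  obtain ⟨C, hC⟩ := ((isCompact_closedBall s₀ δ).prod hvc).exists_bound_of_continuousOn
    (hc.mono (prod_mono_right (subset_univ _)))
  have hs₀ : s₀ ∈ closedBall s₀ δ := mem_closedBall_self hδ.le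
  have hcs : ∀ s ∈ closedBall s₀ δ, Continuous (h' s) := fun s hs =>
    hc.comp_continuous (Continuous.prodMk_right s) fun y => ⟨hs, mem_univ _⟩
  refine (hasDerivAt_integral_of_dominated_loc_of_deriv_le (F := fun s y => v y * h s y)
    (F' := fun s y => v y * h' s y) (bound := fun y => |v y| * C)
    (closedBall_mem_nhds s₀ hδ) ?_ ?_ ?_ ?_ ?_ ?_).2
  · filter_upwards [closedBall_mem_nhds s₀ hδ] with s hs
    exact (hv.mul (hh s hs)).aestronglyMeasurable
  · exact (hv.mul (hh s₀ hs₀)).integrable_of_hasCompactSupport hvc.mul_right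
  · exact (hv.mul (hcs s₀ hs₀)).aestronglyMeasurable
  · refine Eventually.of_forall fun y s hs => ?_
    rw [norm_mul, Real.norm_eq_abs (v y)]
    by_cases hy : y ∈ tsupport v
    · exact mul_le_mul_of_nonneg_left (hC (s, y) ⟨hs, hy⟩) (abs_nonneg _)
    · simp [image_eq_zero_of_notMem_tsupport hy]
  · exact ((hv.integrable_of_hasCompactSupport hvc).norm).mul_const C
  · exact Eventually.of_forall fun y s hs => (hd y s hs).const_mul (v y)

/-- The convolution of `v` with the heat kernel. -/
noncomputable def heatConv (v : Euc N → ℝ) (X : Euc N × ℝ) : ℝ :=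
  ∫ y, v y * heatKer (X.1 - y) X.2

theorem heat_eq_heatConv (v : Euc N → ℝ) (x : Euc N) {τ : ℝ} (hτ : 0 < τ) :
    heat v x τ = (∫ z : Euc N, gaussW z)⁻¹ * heatConv v (x, τ) := by
  have hs : 0 < √τ := Real.sqrt_pos.2 hτ
  rw [heat]
  congr 1
  have h := Measure.integral_comp_smul (volume : Measure (Euc N))
    (fun w => Real.exp (-(‖w‖ ^ 2 / (4 * τ))) * v (x + w)) √τ
  have e1 : ∀ z : Euc N, Real.exp (-(‖√τ • z‖ ^ 2 / (4 * τ))) * v (x + √τ • z)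
      = gaussW z * v (x + √τ • z) := by
    intro z
    rw [norm_smul, mul_pow, Real.norm_of_nonneg hs.le, Real.sq_sqrt hτ.le, gaussW]
    congr 3
    field_simp
  simp only [e1] at h
  rw [h, heatConv, finrank_euclideanSpace_fin, abs_of_pos (by positivity), smul_eq_mul,
    ← integral_const_mul]
  have h3 := integral_sub_left_eq_self (μ := (volume : Measure (Euc N)))
    (fun y => v (x + -y) * heatKer y τ) x
  simp only [neg_sub, add_sub_cancel] at h3
  rw [h3, ← integral_neg_eq_self]
  refine integral_congr_ae (Eventually.of_forall fun w => ?_)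
  have h4 : (√τ ^ N)⁻¹ = τ ^ (-(N / 2 : ℝ)) := by
    rw [Real.rpow_neg hτ.le, Real.sqrt_eq_rpow, ← Real.rpow_natCast, ← Real.rpow_mul hτ.le]
    congr 2; ring
  simp only [h4, heatKer, norm_neg]
  ring

theorem contDiffOn_heatConv {v : Euc N → ℝ} (hv : Continuous v) (hvc : HasCompactSupport v) :
    ContDiffOn ℝ 2 (heatConv v) {X | 0 < X.2} := by
  obtain ⟨R, hR⟩ := hvc.isBounded.subset_closedBall (0 : Euc N)
  let χ : ContDiffBump (0 : Euc N) :=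
    ⟨|R| + 1, |R| + 2, by positivity, by linarith⟩
  have h := contDiffOn_convolution_right_with_param_comp (𝕜 := ℝ) (n := 2) (μ := volume)
    (ContinuousLinearMap.mul ℝ ℝ) (s := {X : Euc N × ℝ | 0 < X.2}) (v := fun _ => (0 : Euc N))
    contDiffOn_const (f := v) (g := fun X y => heatKer (X.1 + y) X.2 * χ y)
    (k := tsupport χ) (isOpen_lt continuous_const continuous_snd) χ.hasCompactSupport
    (fun X y _ hy => by simp [image_eq_zero_of_notMem_tsupport hy])
    hv.locallyIntegrable ?_
  · refine h.congr fun X _ => ?_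
    rw [MeasureTheory.convolution_def, heatConv]
    refine integral_congr_ae (Eventually.of_forall fun y => ?_)
    simp only [zero_sub, ContinuousLinearMap.mul_apply', ← sub_eq_add_neg]
    by_cases hy : y ∈ tsupport v
    · have : χ (-y) = 1 := χ.one_of_mem_closedBall (by
        have := hR hy
        simp only [mem_closedBall, dist_zero_right, norm_neg] at this ⊢
        exact this.trans ((le_abs_self R).trans (by simp [χ])))
      simp [this]
    · simp [image_eq_zero_of_notMem_tsupport hy]
  · refine ContDiffOn.mul ?_ (χ.contDiff.comp contDiff_snd).contDiffOn
    refine contDiffOn_heatKer.comp (f := fun P : (Euc N × ℝ) × Euc N => (P.1.1 + P.2, P.1.2))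
      (ContDiff.contDiffOn (by fun_prop)) ?_
    rintro P ⟨hP, -⟩
    exact hP

theorem fderiv_fderiv_eq_of_hasDerivAt {φ : Euc N → ℝ} {x e : Euc N} {d : ℝ → ℝ} {d₂ : ℝ}
    (hφ : ContDiffAt ℝ 2 φ x) (h1 : ∀ s, HasDerivAt (fun r : ℝ => φ (x + r • e)) (d s) s)
    (h2 : HasDerivAt d d₂ 0) : fderiv ℝ (fderiv ℝ φ) x e e = d₂ := by
  have hline : ∀ s : ℝ, HasDerivAt (fun r : ℝ => x + r • e) e s := fun s => by
    simpa using ((hasDerivAt_id s).smul_const e).const_add x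
  have hx : Tendsto (fun r : ℝ => x + r • e) (𝓝 0) (𝓝 x) := by
    have := (hline 0).continuousAt.tendsto
    simpa using this
  have hev : ∀ᶠ y in 𝓝 x, DifferentiableAt ℝ φ y :=
    (hφ.eventually (by simp)).mono fun y hy => hy.differentiableAt (by norm_num)
  have hd : d =ᶠ[𝓝 0] fun s => fderiv ℝ φ (x + s • e) e := by
    filter_upwards [hx.eventually hev] with s hs
    exact (h1 s).unique (hs.hasFDerivAt.comp_hasDerivAt s (hline s))
  have hf : DifferentiableAt ℝ (fderiv ℝ φ) (x + (0 : ℝ) • e) := by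
    simpa using (hφ.fderiv_right (m := 1) (by norm_num)).differentiableAt (by norm_num)
  have h3 : HasDerivAt (fun s : ℝ => fderiv ℝ φ (x + s • e))
      (fderiv ℝ (fderiv ℝ φ) (x + (0 : ℝ) • e) e) 0 :=
    hf.hasFDerivAt.comp_hasDerivAt 0 (hline 0)
  have h4 : HasDerivAt (fun s : ℝ => fderiv ℝ φ (x + s • e) e)
      (fderiv ℝ (fderiv ℝ φ) (x + (0 : ℝ) • e) e e) 0 :=
    (ContinuousLinearMap.apply ℝ ℝ e).hasFDerivAt.comp_hasDerivAt 0 h3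
  have h5 := (h2.congr_of_eventuallyEq hd.symm).unique h4
  rw [zero_smul, add_zero] at h5
  exact h5.symm

theorem exists_hasJet_heatConv {v : Euc N → ℝ} (hv : Continuous v) (hvc : HasCompactSupport v)
    (x : Euc N) {τ : ℝ} (hτ : 0 < τ) : ∃ a p, HasJet (heatConv v) x τ a p a := by
  have hC : ContDiffAt ℝ 2 (heatConv v) (x, τ) :=
    (contDiffOn_heatConv hv hvc).contDiffAt
      ((isOpen_lt continuous_const continuous_snd).mem_nhds hτ)
  have hK : ContinuousOn (fun X : Euc N × ℝ => heatKer X.1 X.2) {X | 0 < X.2} :=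
    (contDiffOn_heatKer (n := 0)).continuousOn
  have hKx : ∀ {r : ℝ}, 0 < r → Continuous fun w : Euc N => heatKer w r := fun {r} hr =>
    hK.comp_continuous (Continuous.prodMk_left r) fun w => hr
  have htime : HasDerivAt (fun s => heatConv v (x, s))
      (∫ y, v y * ((‖x - y‖ ^ 2 / (4 * τ ^ 2) - N / (2 * τ)) * heatKer (x - y) τ)) τ := by
    have hpos : ∀ s ∈ closedBall τ (τ / 2), 0 < s := by
      intro s hs
      rw [Real.closedBall_eq_Icc] at hs
      linarith [hs.1]
    refine hasDerivAt_integral_mul_of_hasCompactSupport hv hvc (δ := τ / 2) (by positivity)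
      (h := fun s y => heatKer (x - y) s)
      (h' := fun s y => (‖x - y‖ ^ 2 / (4 * s ^ 2) - N / (2 * s)) * heatKer (x - y) s)
      (fun s hs => (hKx (hpos s hs)).comp (by fun_prop))
      (fun y s hs => hasDerivAt_heatKer_time (x - y) (hpos s hs)) ?_
    refine ContinuousOn.mul ?_ (hK.comp (f := fun P : ℝ × Euc N => (x - P.2, P.1))
      (Continuous.continuousOn (by fun_prop)) fun P hP => hpos P.1 hP.1)
    refine ContinuousOn.sub (ContinuousOn.div (by fun_prop) (by fun_prop) ?_)
      (ContinuousOn.div (by fun_prop) (by fun_prop) ?_) <;>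
    · intro P hP
      have := hpos P.1 hP.1
      positivity
  have hspace : ∀ i : Fin N, fderiv ℝ (fderiv ℝ fun y => heatConv v (y, τ)) x
      (EuclideanSpace.single i 1) (EuclideanSpace.single i 1)
      = ∫ y, v y * (((x - y) i ^ 2 / (4 * τ ^ 2) - 1 / (2 * τ)) * heatKer (x - y) τ) := by
    intro i
    set e : Euc N := EuclideanSpace.single i 1 with he
    have h1 : ∀ s : ℝ, HasDerivAt (fun r : ℝ => heatConv v (x + r • e, τ))
        (∫ y, v y * (-(inner ℝ (x - y + s • e) e / (2 * τ)) * heatKer (x - y + s • e) τ)) s := by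
      intro s
      have := hasDerivAt_integral_mul_of_hasCompactSupport hv hvc (δ := 1) (s₀ := s) one_pos
        (h := fun s y => heatKer (x - y + s • e) τ)
        (h' := fun s y => -(inner ℝ (x - y + s • e) e / (2 * τ)) * heatKer (x - y + s • e) τ)
        (fun s hs => (hKx hτ).comp (by fun_prop))
        (fun y s hs => hasDerivAt_heatKer_space (x - y) e hτ s)
        (Continuous.continuousOn (Continuous.mul (by fun_prop) ((hKx hτ).comp (by fun_prop))))
      refine this.congr_of_eventuallyEq (Eventually.of_forall fun r => ?_)
      simp only [heatConv]
      refine integral_congr_ae (Eventually.of_forall fun y => ?_)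
      simp only [add_sub_right_comm]
    have h2 : HasDerivAt (fun s : ℝ => ∫ y, v y *
        (-(inner ℝ (x - y + s • e) e / (2 * τ)) * heatKer (x - y + s • e) τ))
        (∫ y, v y * ((inner ℝ (x - y + (0 : ℝ) • e) e ^ 2 / (4 * τ ^ 2) - ‖e‖ ^ 2 / (2 * τ))
          * heatKer (x - y + (0 : ℝ) • e) τ)) 0 :=
      hasDerivAt_integral_mul_of_hasCompactSupport hv hvc (δ := 1) (s₀ := 0) one_pos
        (h := fun s y => -(inner ℝ (x - y + s • e) e / (2 * τ)) * heatKer (x - y + s • e) τ)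
        (h' := fun s y => (inner ℝ (x - y + s • e) e ^ 2 / (4 * τ ^ 2) - ‖e‖ ^ 2 / (2 * τ))
          * heatKer (x - y + s • e) τ)
        (fun s hs => Continuous.mul (by fun_prop) ((hKx hτ).comp (by fun_prop)))
        (fun y s hs => hasDerivAt_heatKer_space_two (x - y) e hτ s)
        (Continuous.continuousOn (Continuous.mul (by fun_prop) ((hKx hτ).comp (by fun_prop))))
    rw [fderiv_fderiv_eq_of_hasDerivAt hC.slice_fst h1 h2]
    simp [he, EuclideanSpace.inner_single_right]
  refine ⟨_, gradient (fun y => heatConv v (y, τ)) x, hC, htime.deriv, rfl, ?_⟩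
  rw [lapl_eq_sum_fderiv, Finset.sum_congr rfl fun i _ => hspace i, ← integral_finsetSum]
  · refine integral_congr_ae (Eventually.of_forall fun y => ?_)
    simp only [EuclideanSpace.norm_sq_eq, Real.norm_eq_abs, sq_abs]
    rw [← Finset.mul_sum, ← Finset.sum_mul, Finset.sum_sub_distrib, ← Finset.sum_div]
    simp [div_eq_mul_inv]
  · intro i _
    refine Continuous.integrable_of_hasCompactSupport ?_ hvc.mul_right
    exact hv.mul (Continuous.mul (by fun_prop) ((hKx hτ).comp (by fun_prop)))

theorem exists_hasJet_heat {v : Euc N → ℝ} (hv : Continuous v) (hvc : HasCompactSupport v)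
    (x : Euc N) {τ : ℝ} (hτ : 0 < τ) :
    ∃ a p, HasJet (fun X : Euc N × ℝ => heat v X.1 X.2) x τ a p a := by
  obtain ⟨a, p, h⟩ := exists_hasJet_heatConv hv hvc x hτ
  refine ⟨_, _, (h.const_mul (∫ z : Euc N, gaussW z)⁻¹).congr_of_eventuallyEq ?_⟩
  filter_upwards [(isOpen_lt continuous_const continuous_snd).mem_nhds
    (show (x, τ) ∈ {X : Euc N × ℝ | 0 < X.2} from hτ)] with X hX
  exact heat_eq_heatConv v X.1 hX

end Heat

section LinearComparison

variable {N : ℕ}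

theorem HasCompactSupport.slice_fst {v : Euc N × ℝ → ℝ} (hv : HasCompactSupport v) (t : ℝ) :
    HasCompactSupport fun y => v (y, t) :=
  HasCompactSupport.of_support_subset_isCompact (hv.isCompact.image continuous_fst) fun y hy =>
    ⟨(y, t), subset_tsupport v hy, rfl⟩

/-- The quartic barrier used to localize comparison with the heat flow. -/
noncomputable def quarticBarrier (x₀ : Euc N) (t₁ c A B : ℝ) (X : Euc N × ℝ) : ℝ :=
  c * (‖X.1 - x₀‖ ^ 2) ^ 2 + A * (‖X.1 - x₀‖ ^ 2 * (X.2 - t₁)) + B * (X.2 - t₁) ^ 2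

theorem continuous_quarticBarrier (x₀ : Euc N) (t₁ c A B : ℝ) :
    Continuous (quarticBarrier x₀ t₁ c A B) := by
  unfold quarticBarrier
  fun_prop

theorem hasJet_quarticBarrier (x₀ : Euc N) (t₁ c A B : ℝ) (x : Euc N) (t : ℝ) :
    HasJet (quarticBarrier x₀ t₁ c A B) x t
      (A * ‖x - x₀‖ ^ 2 + 2 * B * (t - t₁))
      ((4 * c * ‖x - x₀‖ ^ 2 + 2 * A * (t - t₁)) • (x - x₀))
      (c * ((4 * N + 8) * ‖x - x₀‖ ^ 2) + 2 * N * A * (t - t₁)) := by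
  have h1 := (HasJet.of_fst (t := t) (contDiff_norm_sub_pow_four x₀).contDiffAt (x := x)).const_mul c
  have hd : HasDerivAt (fun s : ℝ => s - t₁) 1 t := (hasDerivAt_id t).sub_const t₁
  have hd2 : HasDerivAt (fun s : ℝ => (s - t₁) ^ 2) (2 * (t - t₁)) t := by
    simpa using hd.fun_pow 2
  have h2 := (HasJet.fst_mul_snd (x := x) (t := t) (contDiff_sq_norm_sub x₀).contDiffAt
    (θ := fun s => s - t₁) (by fun_prop)).const_mul A
  have h3 := (HasJet.of_snd (x := x) (t := t) (θ := fun s => (s - t₁) ^ 2) (by fun_prop)).const_mul B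
  rw [gradient_norm_sub_pow_four, lapl_norm_sub_pow_four] at h1
  rw [gradient_sq_norm_sub, lapl_sq_norm_sub, hd.deriv] at h2
  rw [hd2.deriv] at h3
  refine ((h1.add h2).add h3).congr_val (by ring) ?_ (by ring)
  simp only [smul_smul, smul_zero, add_zero, ← add_smul]
  congr 1; ring

/-- A local viscosity subsolution of `v_t - Δv + ⟨q, Dv⟩ ≤ κ` is dominated, up to a quadratic
error in time, by the heat flow of its values at an earlier time. -/
theorem le_heat_add_of_viscosity {v : Euc N × ℝ → ℝ} (hv : Continuous v)
    (hvc : HasCompactSupport v) {M : ℝ} (hM : ∀ X, |v X| ≤ M) {q x₀ : Euc N} {t₀ r s κ A B : ℝ}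
    (hr : 0 < r) (hs : 0 < s) (hs1 : s ≤ 1)
    (hA : A = (4 * N + 8 + 4 * ‖q‖ * r) / r ^ 4) (hB : B = N * A + A * ‖q‖ * r + 1)
    (H : ∀ x t, ‖x - x₀‖ < r → t₀ - s < t → t ≤ t₀ → ∀ φ a p l, HasJet φ x t a p l →
      IsLocalMaxOn (fun X => v X - φ X) (univ ×ˢ Iic t) (x, t) → a - l + inner ℝ q p ≤ κ) :
    v (x₀, t₀) ≤ heat (fun y => v (y, t₀ - s)) (x₀ - s • q) s + s * κ
      + (2 * M + |κ| + 1) * B * s ^ 2 := by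
  set t₁ := t₀ - s with ht₁
  set L := 2 * M + |κ| + 1 with hL
  have hM0 : 0 ≤ M := (abs_nonneg _).trans (hM (x₀, t₀))
  have hLpos : 0 < L := by positivity
  have hA0 : 0 ≤ A := by rw [hA]; positivity
  set v₁ : Euc N → ℝ := fun y => v (y, t₁) with hv₁
  have hv₁c : Continuous v₁ := hv.comp (Continuous.prodMk_left t₁)
  have hv₁s : HasCompactSupport v₁ :=
    hvc.slice_fst t₁
  set W : Euc N × ℝ → ℝ := fun X => heat v₁ (X.1 - (X.2 - t₁) • q) (X.2 - t₁)
    + (κ * (X.2 - t₁) + L * quarticBarrier x₀ t₁ (r ^ 4)⁻¹ A B X) with hW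
  have hWc : Continuous W := by
    have h1 := continuous_heat hv₁c fun y => hM (y, t₁)
    have h2 : Continuous fun X : Euc N × ℝ => heat v₁ (X.1 - (X.2 - t₁) • q) (X.2 - t₁) :=
      h1.comp (f := fun X : Euc N × ℝ => (X.1 - (X.2 - t₁) • q, X.2 - t₁)) (by fun_prop)
    have h3 := continuous_quarticBarrier x₀ t₁ (r ^ 4)⁻¹ A B
    exact h2.add (by fun_prop)
  have hgoal : v (x₀, t₀) - W (x₀, t₀) ≤ 0 := by
    obtain ⟨⟨x, t⟩, ⟨hx, ht⟩, hmax⟩ := ((isCompact_closedBall x₀ r).prod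
      (isCompact_Icc (a := t₁) (b := t₀))).exists_isMaxOn
      ⟨(x₀, t₀), mem_closedBall_self hr.le, by constructor <;> linarith⟩
      (hv.sub hWc).continuousOn
    simp only [mem_closedBall, dist_eq_norm] at hx
    have hle := hmax (a := (x₀, t₀)) ⟨mem_closedBall_self hr.le, by constructor <;> linarith⟩
    by_contra! hpos
    have hval : 0 < v (x, t) - W (x, t) := hpos.trans_le hle
    have hτ : 0 ≤ t - t₁ := by linarith [ht.1]
    have hbd : 0 ≤ quarticBarrier x₀ t₁ (r ^ 4)⁻¹ A B (x, t) := by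
      have : 0 ≤ B := by rw [hB]; positivity
      unfold quarticBarrier; positivity
    have ht1 : t₁ < t := by
      rcases ht.1.eq_or_lt with h | h
      · exfalso
        subst h
        simp only [hW, sub_self, zero_smul, sub_zero, heat_zero, mul_zero, zero_add] at hval
        have := mul_nonneg hLpos.le hbd
        simp only [hv₁] at hval
        linarith
      · exact h
    have hxr : ‖x - x₀‖ < r := by
      rcases hx.eq_or_lt with h | h
      · exfalso
        have hb1 : 1 ≤ quarticBarrier x₀ t₁ (r ^ 4)⁻¹ A B (x, t) := by
          have hB0 : 0 ≤ B := by rw [hB]; positivity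
          simp only [quarticBarrier, h]
          have : (r ^ 4)⁻¹ * (r ^ 2) ^ 2 = 1 := by field_simp
          rw [this]
          have : 0 ≤ A * (r ^ 2 * (t - t₁)) + B * (t - t₁) ^ 2 := by positivity
          linarith
        have h1 := abs_le.1 (abs_heat_le (fun y => hM (y, t₁)) (x - (t - t₁) • q) (t - t₁))
        have h2 := abs_le.1 (hM (x, t))
        have h3 : -|κ| ≤ κ * (t - t₁) := by
          have h4 : |κ * (t - t₁)| ≤ |κ| := by
            rw [abs_mul, abs_of_nonneg hτ]
            exact mul_le_of_le_one_right (abs_nonneg _) (by linarith [ht.2])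
          linarith [neg_abs_le (κ * (t - t₁))]
        have h5 : L ≤ L * quarticBarrier x₀ t₁ (r ^ 4)⁻¹ A B (x, t) :=
          le_mul_of_one_le_right hLpos.le hb1
        simp only [hW] at hval
        linarith [h1.1, h2.2]
      · exact h
    obtain ⟨a, p, hj⟩ := exists_hasJet_heat hv₁c hv₁s (x - (t - t₁) • q) (sub_pos.2 ht1)
    have hj1 := hj.comp_shear
    have hj2 : HasJet (fun X : Euc N × ℝ => κ * (X.2 - t₁)) x t κ 0 0 := by
      have hd : HasDerivAt (fun s : ℝ => κ * (s - t₁)) κ t := by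
        simpa using ((hasDerivAt_id t).sub_const t₁).const_mul κ
      simpa [hd.deriv] using HasJet.of_snd (x := x) (t := t) (θ := fun s => κ * (s - t₁))
        (by fun_prop)
    have hj3 := (hasJet_quarticBarrier x₀ t₁ (r ^ 4)⁻¹ A B x t).const_mul L
    have hjW : HasJet W x t _ _ _ := hj1.add (hj2.add hj3)
    have hloc : IsLocalMaxOn (fun X => v X - W X) (univ ×ˢ Iic t) (x, t) := by
      have hn : (ball x₀ r ×ˢ Ioi t₁) ∈ 𝓝 (x, t) :=
        prod_mem_nhds (isOpen_ball.mem_nhds (by simpa [dist_eq_norm] using hxr))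
          (Ioi_mem_nhds ht1)
      filter_upwards [mem_nhdsWithin_of_mem_nhds hn, self_mem_nhdsWithin] with X hX hX'
      exact hmax ⟨ball_subset_closedBall hX.1, le_of_lt hX.2, le_trans hX'.2 ht.2⟩
    have hfin := H x t hxr ht1 ht.2 W _ _ _ hjW hloc
    set d := ‖x - x₀‖ with hd
    have hinner : inner ℝ q (x - x₀) ≥ -(‖q‖ * r) := by
      have h1 := abs_real_inner_le_norm q (x - x₀)
      have h2 : ‖q‖ * d ≤ ‖q‖ * r := by gcongr
      linarith [neg_abs_le (inner ℝ q (x - x₀))]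
    have hr4 : 0 < (r ^ 4)⁻¹ := by positivity
    have hAr : A = (r ^ 4)⁻¹ * (4 * N + 8 + 4 * (‖q‖ * r)) := by rw [hA]; ring
    simp only [zero_add, inner_add_right, inner_smul_right] at hfin
    have hcoef : 0 ≤ 4 * (r ^ 4)⁻¹ * d ^ 2 + 2 * A * (t - t₁) := by positivity
    have hkey : 0 < A * d ^ 2 + 2 * B * (t - t₁)
        - ((r ^ 4)⁻¹ * ((4 * N + 8) * d ^ 2) + 2 * N * A * (t - t₁))
        + (4 * (r ^ 4)⁻¹ * d ^ 2 + 2 * A * (t - t₁)) * inner ℝ q (x - x₀) := by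
      have h1 := mul_le_mul_of_nonneg_left hinner hcoef
      have h2 : A * d ^ 2 = (r ^ 4)⁻¹ * ((4 * N + 8) * d ^ 2)
        + 4 * (r ^ 4)⁻¹ * d ^ 2 * (‖q‖ * r) := by rw [hAr]; ring
      have h3 : 2 * B * (t - t₁) = 2 * N * A * (t - t₁) + 2 * A * (t - t₁) * (‖q‖ * r)
        + 2 * (t - t₁) := by rw [hB]; ring
      nlinarith
    have := mul_pos hLpos hkey
    linarith
  have hWval : W (x₀, t₀) = heat v₁ (x₀ - s • q) s + (κ * s + L * (B * s ^ 2)) := by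
    simp [hW, quarticBarrier, ht₁]
  rw [hWval] at hgoal
  linarith

end LinearComparison

section DerivativeTests

variable {N : ℕ}

theorem lapl_nonpos_of_isLocalMax {ψ : Euc N → ℝ} {x : Euc N} (hψ : ContDiffAt ℝ 2 ψ x)
    (hmax : IsLocalMax ψ x) : lapl ψ x ≤ 0 := by
  rw [lapl_eq_sum_fderiv]
  refine Finset.sum_nonpos fun i _ => ?_
  set e : Euc N := EuclideanSpace.single i 1
  have hline : ∀ s : ℝ, HasDerivAt (fun r : ℝ => x + r • e) e s := fun s => by
    simpa using ((hasDerivAt_id s).smul_const e).const_add x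
  have hx : Tendsto (fun r : ℝ => x + r • e) (𝓝 0) (𝓝 x) := by
    simpa using (hline 0).continuousAt.tendsto
  have hev : ∀ᶠ y in 𝓝 x, DifferentiableAt ℝ ψ y :=
    (hψ.eventually (by simp)).mono fun y hy => hy.differentiableAt (by norm_num)
  have hd : (deriv fun r : ℝ => ψ (x + r • e)) =ᶠ[𝓝 0] fun s => fderiv ℝ ψ (x + s • e) e := by
    filter_upwards [hx.eventually hev] with s hs
    exact (hs.hasFDerivAt.comp_hasDerivAt s (hline s)).deriv
  have hf : DifferentiableAt ℝ (fderiv ℝ ψ) (x + (0 : ℝ) • e) := by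
    simpa using (hψ.fderiv_right (m := 1) (by norm_num)).differentiableAt (by norm_num)
  have h3 : HasDerivAt (fun s : ℝ => fderiv ℝ ψ (x + s • e))
      (fderiv ℝ (fderiv ℝ ψ) (x + (0 : ℝ) • e) e) 0 :=
    hf.hasFDerivAt.comp_hasDerivAt 0 (hline 0)
  have h4 : HasDerivAt (fun s : ℝ => fderiv ℝ ψ (x + s • e) e)
      (fderiv ℝ (fderiv ℝ ψ) (x + (0 : ℝ) • e) e e) 0 :=
    (ContinuousLinearMap.apply ℝ ℝ e).hasFDerivAt.comp_hasDerivAt 0 h3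
  rw [zero_smul, add_zero] at h4
  have h5 := (h4.congr_of_eventuallyEq hd).deriv
  have hmaxline : IsLocalMax (fun r : ℝ => ψ (x + r • e)) 0 := by
    have := hx.eventually hmax
    filter_upwards [this] with r hr
    simpa using hr
  by_contra! hpos
  have hcont : ContinuousAt (fun r : ℝ => ψ (x + r • e)) 0 := by
    have h6 : ContinuousAt ψ (x + (0 : ℝ) • e) := by simpa using hψ.continuousAt
    exact ContinuousAt.comp (f := fun r : ℝ => x + r • e) h6 (hline 0).continuousAt
  have hmin := isLocalMin_of_deriv_deriv_pos (f := fun r : ℝ => ψ (x + r • e)) (x₀ := 0)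
    (by rw [h5]; exact hpos) hmaxline.deriv_eq_zero hcont
  have hconst : (fun r : ℝ => ψ (x + r • e)) =ᶠ[𝓝 0] fun _ => ψ (x + (0 : ℝ) • e) := by
    filter_upwards [hmin, hmaxline] with r h1 h2 using le_antisymm h2 h1
  have h7 : deriv (deriv fun r : ℝ => ψ (x + r • e)) 0 = 0 := by
    rw [hconst.deriv.deriv_eq]; simp
  rw [h7] at h5
  exact hpos.ne h5

theorem deriv_nonneg_of_isLocalMaxOn_Iic {h : ℝ → ℝ} {t : ℝ} (hmax : IsLocalMaxOn h (Iic t) t) :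
    0 ≤ deriv h t := by
  by_cases hd : DifferentiableAt ℝ h t
  · have h1 := (hasDerivWithinAt_iff_tendsto_slope' (s := Iio t) (by simp)).1
      hd.hasDerivAt.hasDerivWithinAt
    refine ge_of_tendsto h1 ?_
    filter_upwards [self_mem_nhdsWithin, hmax.filter_mono (nhdsWithin_mono t Iio_subset_Iic_self)]
      with s hs hle
    rw [slope_def_field]
    exact div_nonneg_of_nonpos (sub_nonpos.2 hle) (sub_nonpos.2 (le_of_lt hs))
  · rw [deriv_zero_of_not_differentiableAt hd]

theorem HasJet.of_isLocalMaxOn {ψ : Euc N × ℝ → ℝ} {x p : Euc N} {t a l : ℝ}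
    (hψ : HasJet ψ x t a p l) (hmax : IsLocalMaxOn ψ (univ ×ˢ Iic t) (x, t)) :
    0 ≤ a ∧ p = 0 ∧ l ≤ 0 := by
  have h1 : IsLocalMaxOn (fun s => ψ (x, s)) (Iic t) t := by
    have : Tendsto (fun s : ℝ => (x, s)) (𝓝[Iic t] t) (𝓝[univ ×ˢ Iic t] (x, t)) :=
      tendsto_nhdsWithin_iff.2 ⟨(Continuous.prodMk_right x).continuousWithinAt,
        eventually_nhdsWithin_of_forall fun s hs => ⟨mem_univ _, hs⟩⟩
    exact this.eventually hmax
  have h2 : IsLocalMax (fun y => ψ (y, t)) x := by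
    have : Tendsto (fun y : Euc N => (y, t)) (𝓝 x) (𝓝[univ ×ˢ Iic t] (x, t)) :=
      tendsto_nhdsWithin_iff.2 ⟨(Continuous.prodMk_left t).continuousAt,
        Eventually.of_forall fun y => ⟨mem_univ _, mem_Iic.2 le_rfl⟩⟩
    exact this.eventually hmax
  refine ⟨hψ.2.1 ▸ deriv_nonneg_of_isLocalMaxOn_Iic h1, ?_,
    hψ.2.2.2 ▸ lapl_nonpos_of_isLocalMax hψ.1.slice_fst h2⟩
  rw [← hψ.2.2.1, gradient, h2.fderiv_eq_zero, map_zero]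

theorem continuous_deriv_snd {U : Euc N × ℝ → ℝ} (hU : ContDiff ℝ 2 U) :
    Continuous fun X : Euc N × ℝ => deriv (fun s => U (X.1, s)) X.2 := by
  have h : (fun X : Euc N × ℝ => deriv (fun s => U (X.1, s)) X.2)
      = fun X => fderiv ℝ U X ((0 : Euc N), (1 : ℝ)) := by
    ext X
    have h1 : HasDerivAt (fun s : ℝ => (X.1, s)) ((0 : Euc N), (1 : ℝ)) X.2 :=
      (hasDerivAt_const _ _).prodMk (hasDerivAt_id _)
    exact ((hU.differentiable (by norm_num) (X.1, X.2)).hasFDerivAt.comp_hasDerivAt X.2 h1).deriv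
  rw [h]
  exact (hU.continuous_fderiv (by norm_num)).clm_apply continuous_const

theorem fderiv_slice_fst {F : Type*} [NormedAddCommGroup F] [NormedSpace ℝ F]
    {U : Euc N × ℝ → F} (hU : Differentiable ℝ U) (x : Euc N) (t : ℝ) :
    fderiv ℝ (fun y => U (y, t)) x
      = (fderiv ℝ U (x, t)).comp (ContinuousLinearMap.inl ℝ (Euc N) ℝ) :=
  ((hU (x, t)).hasFDerivAt.comp x (hasFDerivAt_prodMk_left x t)).fderiv

theorem continuous_gradient_fst {U : Euc N × ℝ → ℝ} (hU : ContDiff ℝ 2 U) :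
    Continuous fun X : Euc N × ℝ => gradient (fun y => U (y, X.2)) X.1 := by
  simp only [gradient, fderiv_slice_fst (hU.differentiable (by norm_num))]
  exact (InnerProductSpace.toDual ℝ (Euc N)).symm.continuous.comp
    ((hU.continuous_fderiv (by norm_num)).clm_comp continuous_const)

theorem continuous_lapl_fst {U : Euc N × ℝ → ℝ} (hU : ContDiff ℝ 2 U) :
    Continuous fun X : Euc N × ℝ => lapl (fun y => U (y, X.2)) X.1 := by
  have hd : ContDiff ℝ 1 (fderiv ℝ U) := hU.fderiv_right (by norm_num)
  have h : (fun X : Euc N × ℝ => lapl (fun y => U (y, X.2)) X.1) = fun X => ∑ i : Fin N,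
      fderiv ℝ (fderiv ℝ U) X (EuclideanSpace.single i 1, 0) (EuclideanSpace.single i 1, 0) := by
    ext X
    rw [lapl_eq_sum_fderiv]
    refine Finset.sum_congr rfl fun i _ => ?_
    have e1 : fderiv ℝ (fun y => U (y, X.2)) = fun y =>
        (fderiv ℝ U (y, X.2)).comp (ContinuousLinearMap.inl ℝ (Euc N) ℝ) := by
      ext1 y
      exact fderiv_slice_fst (hU.differentiable (by norm_num)) y X.2
    have e2 : HasFDerivAt (fun y => fderiv ℝ U (y, X.2))
        ((fderiv ℝ (fderiv ℝ U) (X.1, X.2)).comp (ContinuousLinearMap.inl ℝ (Euc N) ℝ)) X.1 :=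
      (hd.differentiable (by norm_num) (X.1, X.2)).hasFDerivAt.comp X.1
        (hasFDerivAt_prodMk_left X.1 X.2)
    rw [e1, (e2.clm_comp (hasFDerivAt_const _ _)).fderiv]
    simp
  rw [h]
  have h2 : Continuous (fderiv ℝ (fderiv ℝ U)) := hd.continuous_fderiv (by norm_num)
  exact continuous_finsetSum _ fun i _ => (h2.clm_apply continuous_const).clm_apply continuous_const

theorem rpow_norm_add_inner_le {m : ℝ} (hm : 1 < m) (p₀ p : Euc N) :
    ‖p₀‖ ^ m + inner ℝ ((m * ‖p₀‖ ^ (m - 2)) • p₀) (p - p₀) ≤ ‖p‖ ^ m := by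
  rcases eq_or_ne p₀ 0 with rfl | h0
  · simp only [norm_zero, smul_zero, inner_zero_left, add_zero]
    rw [Real.zero_rpow (by linarith)]
    positivity
  have ha : 0 < ‖p₀‖ := norm_pos_iff.2 h0
  have h1 := one_add_mul_self_le_rpow_one_add (s := ‖p‖ / ‖p₀‖ - 1)
    (by linarith [div_nonneg (norm_nonneg p) ha.le]) hm.le
  rw [add_sub_cancel, Real.div_rpow (norm_nonneg p) ha.le, le_div_iff₀ (by positivity)] at h1
  have h2 : inner ℝ ((m * ‖p₀‖ ^ (m - 2)) • p₀) (p - p₀)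
      ≤ m * ‖p₀‖ ^ (m - 2) * (‖p₀‖ * ‖p‖ - ‖p₀‖ ^ 2) := by
    rw [real_inner_smul_left, inner_sub_right, real_inner_self_eq_norm_sq]
    gcongr
    exact real_inner_le_norm _ _
  have h3 : ‖p₀‖ ^ m = ‖p₀‖ ^ (m - 2) * ‖p₀‖ ^ 2 := by
    rw [← Real.rpow_natCast, ← Real.rpow_add ha]; congr 1; norm_num
  refine le_trans ?_ h1
  refine (add_le_add_right h2 _).trans (le_of_eq ?_)
  rw [h3]
  field_simp

theorem rpow_norm_convex {m : ℝ} (hm : 1 < m) {θ : ℝ} (h0 : 0 ≤ θ) (h1 : θ ≤ 1) (p q : Euc N) :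
    ‖θ • p + (1 - θ) • q‖ ^ m ≤ θ * ‖p‖ ^ m + (1 - θ) * ‖q‖ ^ m := by
  have hn : ‖θ • p + (1 - θ) • q‖ ≤ θ * ‖p‖ + (1 - θ) * ‖q‖ := by
    refine (norm_add_le _ _).trans (le_of_eq ?_)
    rw [norm_smul, norm_smul, Real.norm_of_nonneg h0, Real.norm_of_nonneg (by linarith)]
  refine (Real.rpow_le_rpow (norm_nonneg _) hn (by linarith)).trans ?_
  simpa using (convexOn_rpow hm.le).2 (norm_nonneg p) (norm_nonneg q) h0
    (by linarith : 0 ≤ 1 - θ) (by ring)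

end DerivativeTests

section Mollification

variable {N : ℕ}

/-- The mollification of `v` with weight `ρ`. -/
noncomputable def mollify (ρ v : Euc N × ℝ → ℝ) (X : Euc N × ℝ) : ℝ := ∫ Y, ρ Y * v (X - Y)

theorem mollify_eq_convolution (ρ v : Euc N × ℝ → ℝ) :
    mollify ρ v = MeasureTheory.convolution ρ v (ContinuousLinearMap.mul ℝ ℝ) volume := by
  ext X
  simp [mollify, MeasureTheory.convolution_def]

theorem contDiff_mollify {ρ v : Euc N × ℝ → ℝ} (hρ : ContDiff ℝ 2 ρ) (hρc : HasCompactSupport ρ)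
    (hv : Continuous v) : ContDiff ℝ 2 (mollify ρ v) := by
  rw [mollify_eq_convolution]
  have : (volume : Measure (Euc N × ℝ)).IsAddHaarMeasure :=
    inferInstanceAs ((volume : Measure (Euc N)).prod (volume : Measure ℝ)).IsAddHaarMeasure
  have : (volume : Measure (Euc N × ℝ)).IsNegInvariant :=
    Measure.IsAddHaarMeasure.isNegInvariant_of_regular _
  exact_mod_cast HasCompactSupport.contDiff_convolution_left (n := 2)
    (ContinuousLinearMap.mul ℝ ℝ) hρc (by exact_mod_cast hρ) hv.locallyIntegrable

theorem hasCompactSupport_mollify {ρ v : Euc N × ℝ → ℝ} (hρc : HasCompactSupport ρ)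
    (hvc : HasCompactSupport v) : HasCompactSupport (mollify ρ v) := by
  rw [mollify_eq_convolution]
  exact hρc.convolution _ hvc

theorem integrable_mul_of_hasCompactSupport {ρ k : Euc N × ℝ → ℝ} (hρ : Continuous ρ)
    (hρc : HasCompactSupport ρ) (hk : Continuous k) : Integrable fun Y => ρ Y * k Y :=
  (hρ.mul hk).integrable_of_hasCompactSupport hρc.mul_right

theorem abs_mollify_le {ρ v : Euc N × ℝ → ℝ} (hρ : Continuous ρ) (hρc : HasCompactSupport ρ)
    (hρ0 : ∀ Y, 0 ≤ ρ Y) (hρ1 : ∫ Y, ρ Y = 1) {M : ℝ} (hM : ∀ X, |v X| ≤ M) (X : Euc N × ℝ) :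
    |mollify ρ v X| ≤ M := by
  have : |mollify ρ v X| ≤ ∫ Y, ρ Y * M := by
    rw [← Real.norm_eq_abs]
    refine norm_integral_le_of_norm_le ((hρ.integrable_of_hasCompactSupport hρc).mul_const M)
      (Eventually.of_forall fun Y => ?_)
    rw [norm_mul, Real.norm_of_nonneg (hρ0 Y)]
    exact mul_le_mul_of_nonneg_left (hM _) (hρ0 Y)
  rwa [integral_mul_const, hρ1, one_mul] at this

theorem heat_mollify {ρ v : Euc N × ℝ → ℝ} (hρ : Continuous ρ) (hρc : HasCompactSupport ρ)
    (hv : Continuous v) {M : ℝ} (hM : ∀ X, |v X| ≤ M) (x : Euc N) (t τ : ℝ) :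
    ∫ Y, ρ Y * heat (fun y => v (y, t - Y.2)) (x - Y.1) τ
      = heat (fun y => mollify ρ v (y, t)) x τ := by
  simp only [heat, mollify]
  have h1 : ∀ Y : Euc N × ℝ, ρ Y * ((∫ z : Euc N, gaussW z)⁻¹ *
      ∫ z : Euc N, gaussW z * v (x - Y.1 + √τ • z, t - Y.2))
      = (∫ z : Euc N, gaussW z)⁻¹ *
        ∫ z : Euc N, ρ Y * (gaussW z * v (x - Y.1 + √τ • z, t - Y.2)) := by
    intro Y; rw [integral_const_mul]; ring
  simp only [h1]
  rw [integral_const_mul, integral_integral_swap]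
  · congr 1
    refine integral_congr_ae (Eventually.of_forall fun z => ?_)
    simp only
    rw [← integral_const_mul]
    refine integral_congr_ae (Eventually.of_forall fun Y => ?_)
    have : ((x + √τ • z, t) : Euc N × ℝ) - Y = (x - Y.1 + √τ • z, t - Y.2) := by
      ext1
      · simp only [Prod.fst_sub]; abel
      · rfl
    simp only [this]; ring
  · have h2 := Integrable.mul_prod (hρ.integrable_of_hasCompactSupport hρc (μ := volume))
      (integrable_gaussW (N := N))
    have h3 : Continuous fun P : (Euc N × ℝ) × Euc N => v (x - P.1.1 + √τ • P.2, t - P.1.2) :=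
      hv.comp (by fun_prop)
    refine (h2.bdd_mul h3.aestronglyMeasurable (c := M)
      (Eventually.of_forall fun P => hM _)).congr (Eventually.of_forall fun P => ?_)
    simp only [Function.uncurry]; ring

set_option maxHeartbeats 1000000 in
/-- Mollifications of viscosity subsolutions of a linear equation are classical subsolutions. -/
theorem mollify_linear_le {v k ρ : Euc N × ℝ → ℝ} (hv : Continuous v)
    (hvc : HasCompactSupport v) (hk : Continuous k) (hρ : ContDiff ℝ 2 ρ)
    (hρc : HasCompactSupport ρ) (hρ0 : ∀ Y, 0 ≤ ρ Y) (hρ1 : ∫ Y, ρ Y = 1)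
    {Q : Set (Euc N × ℝ)} (hQ : IsOpen Q) {q x₀ : Euc N} {t₀ : ℝ}
    (hsub : ∀ Y ∈ tsupport ρ, (x₀, t₀) - Y ∈ Q)
    (H : ∀ x t, (x, t) ∈ Q → ∀ φ a p l, HasJet φ x t a p l →
      IsLocalMaxOn (fun X => v X - φ X) (univ ×ˢ Iic t) (x, t) → a - l + inner ℝ q p ≤ k (x, t))
    {a l : ℝ} {p : Euc N} (hU : HasJet (mollify ρ v) x₀ t₀ a p l) :
    a - l + inner ℝ q p ≤ ∫ Y, ρ Y * k ((x₀, t₀) - Y) := by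
  set U := mollify ρ v with hUdef
  obtain ⟨M, hM⟩ : ∃ M, ∀ X, |v X| ≤ M := hv.bounded_above_of_compact_support hvc
  have hU2 : ContDiff ℝ 2 U := contDiff_mollify hρ hρc hv
  have hUc : HasCompactSupport U := hasCompactSupport_mollify hρc hvc
  have hUM : ∀ X, |U X| ≤ M := abs_mollify_le hρ.continuous hρc hρ0 hρ1 hM
  set κ := ∫ Y, ρ Y * k ((x₀, t₀) - Y) with hκ
  set G : Euc N × ℝ → ℝ := fun X => deriv (fun s => U (X.1, s)) X.2
    - lapl (fun y => U (y, X.2)) X.1 + inner ℝ q (gradient (fun y => U (y, X.2)) X.1) with hG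
  have hGc : Continuous G := ((continuous_deriv_snd hU2).sub (continuous_lapl_fst hU2)).add
    (continuous_const.inner (continuous_gradient_fst hU2))
  have hGX : a - l + inner ℝ q p = G (x₀, t₀) := by
    simp only [hG, hU.2.1, hU.2.2.1, hU.2.2.2]
  rw [hGX]
  by_contra! hlt
  set η := (G (x₀, t₀) - κ) / 3 with hη
  have hηpos : 0 < η := by rw [hη]; linarith
  -- The compact set where the viscosity inequality is used.
  set K : Set (Euc N × ℝ) := (fun Y => (x₀, t₀) - Y) '' tsupport ρ with hKdef
  have hK : IsCompact K := hρc.isCompact.image (by fun_prop)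
  have hKQ : K ⊆ Q := by rintro _ ⟨Y, hY, rfl⟩; exact hsub Y hY
  obtain ⟨r₁, hr₁, hr₁Q⟩ := hK.exists_cthickening_subset_open hQ hKQ
  obtain ⟨r₂, hr₂, hr₂k⟩ := Metric.mem_uniformity_dist.1
    (hK.uniformContinuousAt_of_continuousAt k (fun _ _ => hk.continuousAt)
      (Metric.dist_mem_uniformity hηpos))
  obtain ⟨r₃, hr₃, hr₃G⟩ := Metric.continuousAt_iff.1 (hGc.continuousAt (x := (x₀, t₀))) η hηpos
  obtain ⟨k₀, hk₀⟩ := hK.exists_bound_of_continuousOn hk.continuousOn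
  set r := min (min r₁ r₂) (min r₃ 1) with hr
  have hrpos : 0 < r := by simp [hr, hr₁, hr₂, hr₃]
  have hrr₁ : r ≤ r₁ := (min_le_left _ _).trans (min_le_left _ _)
  have hrr₂ : r ≤ r₂ := (min_le_left _ _).trans (min_le_right _ _)
  have hrr₃ : r ≤ r₃ := (min_le_right _ _).trans (min_le_left _ _)
  have hr1 : r ≤ 1 := (min_le_right _ _).trans (min_le_right _ _)
  set A := (4 * N + 8 + 4 * ‖q‖ * r) / r ^ 4 with hA
  set B := N * A + A * ‖q‖ * r + 1 with hB
  have hB0 : 0 ≤ B := by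
    have : 0 ≤ A := by rw [hA]; positivity
    rw [hB]; positivity
  have hM0 : 0 ≤ M := (abs_nonneg _).trans (hM 0)
  set C₁ := (2 * M + (|k₀| + η) + 1) * B with hC₁
  set C₂ := (2 * M + |-(κ + 2 * η)| + 1) * B with hC₂
  have hC₁0 : 0 ≤ C₁ := by positivity
  have hC₂0 : 0 ≤ C₂ := by positivity
  have hdist : ∀ {x y : Euc N} {t s : ℝ}, ‖x - y‖ < r → s - r < t → t ≤ s →
      dist ((x, t) : Euc N × ℝ) (y, s) < r := by
    intro x y t s h1 h2 h3
    rw [Prod.dist_eq, max_lt_iff]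
    refine ⟨by simpa [dist_eq_norm] using h1, ?_⟩
    simp only [Real.dist_eq, abs_lt]
    constructor <;> linarith
  -- The lower bound from the smoothness of `U`.
  have lower : ∀ s, 0 < s → s ≤ r → heat (fun y => U (y, t₀ - s)) (x₀ - s • q) s
      + s * (κ + 2 * η) - C₂ * s ^ 2 ≤ U (x₀, t₀) := by
    intro s hs hsr
    have := le_heat_add_of_viscosity (v := fun X => - U X) hU2.continuous.neg hUc.neg
      (M := M) (fun X => by rw [abs_neg]; exact hUM X) (q := q) (x₀ := x₀) (t₀ := t₀)
      (κ := -(κ + 2 * η)) hrpos hs (hsr.trans hr1) hA hB ?_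
    · have hneg : heat (fun y => - U (y, t₀ - s)) (x₀ - s • q) s
          = - heat (fun y => U (y, t₀ - s)) (x₀ - s • q) s := by
        simp only [heat, mul_neg, integral_neg]
      rw [hneg] at this
      rw [← hC₂] at this
      linarith
    · intro x t hx ht1 ht2 φ b p' l' hφ hmax
      have hjU := hU2.contDiffAt.hasJet (x := x) (t := t)
      have hj := hjU.neg.add hφ.neg
      obtain ⟨h1, h2, h3⟩ := hj.of_isLocalMaxOn (hmax.congr (Eventually.of_forall fun X => by
        simp only [sub_eq_add_neg]) (by simp))
      have h4 : p' = - gradient (fun y => U (y, t)) x := by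
        rw [← sub_eq_add_neg, sub_eq_zero] at h2; exact h2.symm
      have h5 := hr₃G ((hdist hx (by linarith) ht2).trans_le hrr₃)
      rw [Real.dist_eq, abs_lt] at h5
      rw [h4, inner_neg_right]
      have h6 : G (x, t) = deriv (fun s => U (x, s)) t - lapl (fun y => U (y, t)) x
        + inner ℝ q (gradient (fun y => U (y, t)) x) := rfl
      have h7 : κ + 2 * η ≤ G (x, t) := by
        have : G (x₀, t₀) = κ + 3 * η := by rw [hη]; ring
        linarith [h5.1]
      linarith
  -- The upper bound from the viscosity inequality.
  have upper : ∀ s, 0 < s → s ≤ r → U (x₀, t₀) ≤ heat (fun y => U (y, t₀ - s)) (x₀ - s • q) s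
      + s * (κ + η) + C₁ * s ^ 2 := by
    intro s hs hsr
    have hpt : ∀ Y, ρ Y * v ((x₀, t₀) - Y) ≤
        ρ Y * heat (fun y => v (y, t₀ - s - Y.2)) (x₀ - s • q - Y.1) s
          + s * (ρ Y * k ((x₀, t₀) - Y)) + ρ Y * (s * η + C₁ * s ^ 2) := by
      intro Y
      by_cases hY : Y ∈ tsupport ρ
      · have hYK : (x₀, t₀) - Y ∈ K := ⟨Y, hY, rfl⟩
        have h1 := le_heat_add_of_viscosity hv hvc hM (q := q) (x₀ := x₀ - Y.1) (t₀ := t₀ - Y.2)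
          (κ := k ((x₀, t₀) - Y) + η) hrpos hs (hsr.trans hr1) hA hB ?_
        · have hb : |k ((x₀, t₀) - Y) + η| ≤ |k₀| + η := by
            refine (abs_add_le _ _).trans ?_
            rw [abs_of_pos hηpos]
            have := (hk₀ _ hYK).trans (le_abs_self k₀)
            rw [Real.norm_eq_abs] at this
            linarith
          have hb2 : (2 * M + |k ((x₀, t₀) - Y) + η| + 1) * B * s ^ 2 ≤ C₁ * s ^ 2 := by
            rw [hC₁]; gcongr
          have h2 : v ((x₀, t₀) - Y) ≤ heat (fun y => v (y, t₀ - s - Y.2)) (x₀ - s • q - Y.1) s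
              + s * (k ((x₀, t₀) - Y) + η) + C₁ * s ^ 2 := by
            have e1 : t₀ - Y.2 - s = t₀ - s - Y.2 := by ring
            have e2 : x₀ - Y.1 - s • q = x₀ - s • q - Y.1 := by abel
            rw [e1, e2] at h1
            exact h1.trans (by linarith)
          have := mul_le_mul_of_nonneg_left h2 (hρ0 Y)
          linarith
        · intro x t hx ht1 ht2 φ b p' l' hφ hmax
          have hd := hdist hx (by linarith) ht2
          have hd' : dist (x, t) ((x₀, t₀) - Y) < r := hd
          have hmem : (x, t) ∈ Q := hr₁Q (mem_cthickening_of_dist_le _ _ _ _ hYK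
            (hd'.le.trans hrr₁))
          refine (H x t hmem φ b p' l' hφ hmax).trans ?_
          have := hr₂k (a := (x₀, t₀) - Y) (b := (x, t))
            (by rw [dist_comm]; exact hd'.trans_le hrr₂) hYK
          simp only [mem_ofPred_eq, Real.dist_eq, abs_lt] at this
          linarith [this.1]
      · simp [image_eq_zero_of_notMem_tsupport hY]
    have i1 : Integrable fun Y => ρ Y * v ((x₀, t₀) - Y) :=
      integrable_mul_of_hasCompactSupport hρ.continuous hρc (hv.comp (by fun_prop))
    have i2 : Integrable fun Y : Euc N × ℝ => ρ Y *
        heat (fun y => v (y, t₀ - s - Y.2)) (x₀ - s • q - Y.1) s := by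
      refine integrable_mul_of_hasCompactSupport hρ.continuous hρc ?_
      refine continuous_const.mul (continuous_integral_gaussW_mul (M := M)
        (G := fun (Y : Euc N × ℝ) z => v (x₀ - s • q - Y.1 + √s • z, t₀ - s - Y.2))
        (hv.comp (by fun_prop)) fun _ _ => hM _)
    have i3 : Integrable fun Y => ρ Y * k ((x₀, t₀) - Y) :=
      integrable_mul_of_hasCompactSupport hρ.continuous hρc (hk.comp (by fun_prop))
    have i4 : Integrable ρ := hρ.continuous.integrable_of_hasCompactSupport hρc
    have h3 := integral_mono i1 ((i2.add (i3.const_mul s)).add (i4.mul_const _)) hpt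
    have h4 : ∫ Y, (ρ Y * heat (fun y => v (y, t₀ - s - Y.2)) (x₀ - s • q - Y.1) s
          + s * (ρ Y * k ((x₀, t₀) - Y)) + ρ Y * (s * η + C₁ * s ^ 2))
        = heat (fun y => U (y, t₀ - s)) (x₀ - s • q) s + s * κ + (s * η + C₁ * s ^ 2) := by
      have i5 : Integrable fun Y : Euc N × ℝ => ρ Y *
          heat (fun y => v (y, t₀ - s - Y.2)) (x₀ - s • q - Y.1) s
            + s * (ρ Y * k ((x₀, t₀) - Y)) := i2.add (i3.const_mul s)
      rw [integral_add i5 (i4.mul_const _),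
        integral_add i2 (i3.const_mul s), integral_const_mul, integral_mul_const, hρ1, one_mul,
        heat_mollify hρ.continuous hρc hv hM]
    have h5 : U (x₀, t₀) ≤ _ := h3.trans (le_of_eq h4)
    linarith
  set s := min r (η / (2 * (C₁ + C₂ + 1))) with hs
  have hspos : 0 < s := by rw [hs, lt_min_iff]; exact ⟨hrpos, by positivity⟩
  have h1 := lower s hspos (min_le_left _ _)
  have h2 := upper s hspos (min_le_left _ _)
  have h3 : s * (2 * (C₁ + C₂ + 1)) ≤ η := by
    rw [← le_div_iff₀ (by positivity)]; exact min_le_right _ _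
  have h4 : s * η ≤ (C₁ + C₂) * s ^ 2 := by linarith
  have h5 : η ≤ (C₁ + C₂) * s := by
    refine le_of_mul_le_mul_left ?_ hspos
    calc s * η ≤ (C₁ + C₂) * s ^ 2 := h4
      _ = s * ((C₁ + C₂) * s) := by ring
  nlinarith

/-- Mollifications of viscosity subsolutions of the viscous Hamilton–Jacobi equation are
classical subsolutions, by convexity of the Hamiltonian. -/
theorem mollify_hamilton_le {m lam : ℝ} (hm : 1 < m) {v ρ : Euc N × ℝ → ℝ} {f : Euc N → ℝ}
    (hv : Continuous v) (hvc : HasCompactSupport v) (hf : Continuous f) (hρ : ContDiff ℝ 2 ρ)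
    (hρc : HasCompactSupport ρ) (hρ0 : ∀ Y, 0 ≤ ρ Y) (hρ1 : ∫ Y, ρ Y = 1)
    {Q : Set (Euc N × ℝ)} (hQ : IsOpen Q) {x₀ : Euc N} {t₀ : ℝ}
    (hsub : ∀ Y ∈ tsupport ρ, (x₀, t₀) - Y ∈ Q)
    (H : ∀ x t, (x, t) ∈ Q → ∀ φ a p l, HasJet φ x t a p l →
      IsLocalMaxOn (fun X => v X - φ X) (univ ×ˢ Iic t) (x, t) →
      a - l + ‖p‖ ^ m + lam * v (x, t) ≤ f x)
    {a l : ℝ} {p : Euc N} (hU : HasJet (mollify ρ v) x₀ t₀ a p l) :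
    a - l + ‖p‖ ^ m + lam * mollify ρ v (x₀, t₀) ≤ mollify ρ (fun X => f X.1) (x₀, t₀) := by
  set q := (m * ‖p‖ ^ (m - 2)) • p with hq
  have i1 : Integrable fun Y => ρ Y * f ((x₀, t₀) - Y).1 :=
    integrable_mul_of_hasCompactSupport hρ.continuous hρc (hf.comp (by fun_prop))
  have i2 : Integrable fun Y => ρ Y * v ((x₀, t₀) - Y) :=
    integrable_mul_of_hasCompactSupport hρ.continuous hρc (hv.comp (by fun_prop))
  have i3 : Integrable ρ := hρ.continuous.integrable_of_hasCompactSupport hρc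
  have h := mollify_linear_le (q := q)
    (k := fun X => f X.1 - lam * v X + (inner ℝ q p - ‖p‖ ^ m)) hv hvc (by fun_prop) hρ hρc
    hρ0 hρ1 hQ hsub ?_ hU
  · have e : ∫ Y, ρ Y * (f ((x₀, t₀) - Y).1 - lam * v ((x₀, t₀) - Y) + (inner ℝ q p - ‖p‖ ^ m))
        = mollify ρ (fun X => f X.1) (x₀, t₀) - lam * mollify ρ v (x₀, t₀)
          + (inner ℝ q p - ‖p‖ ^ m) := by
      have : ∀ Y, ρ Y * (f ((x₀, t₀) - Y).1 - lam * v ((x₀, t₀) - Y) + (inner ℝ q p - ‖p‖ ^ m))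
          = ρ Y * f ((x₀, t₀) - Y).1 - lam * (ρ Y * v ((x₀, t₀) - Y))
            + ρ Y * (inner ℝ q p - ‖p‖ ^ m) := fun Y => by ring
      simp only [this]
      have i4 : Integrable fun Y => ρ Y * f ((x₀, t₀) - Y).1
          - lam * (ρ Y * v ((x₀, t₀) - Y)) := i1.sub (i2.const_mul lam)
      rw [integral_add i4 (i3.mul_const _),
        integral_sub i1 (i2.const_mul lam), integral_const_mul, integral_mul_const, hρ1, one_mul]
      rfl
    simp only [e] at h
    linarith
  · intro x t hx φ b p' l' hφ hmax
    have h1 := H x t hx φ b p' l' hφ hmax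
    have h2 := rpow_norm_add_inner_le hm p p'
    rw [inner_sub_right, ← hq] at h2
    linarith

end Mollification

section ViscositySub

variable {N : ℕ}

/-- Viscosity subsolutions of `u_t - Δu + σ|Du|^m + λu = f` with generalized Dirichlet
condition `u = g`, with test functions given by their jets. -/
def VisSub (σ : ℝ) (Ω : Set (Euc N)) (f g : Euc N → ℝ) (lam m : ℝ) (u : Euc N → ℝ → ℝ) : Prop :=
  ∀ x ∈ closure Ω, ∀ t > 0, ∀ φ a p l, HasJet φ x t a p l →
    IsLocalMaxOn (fun X : Euc N × ℝ => u X.1 X.2 - φ X) (closure Ω ×ˢ Iic t) (x, t) →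
    a - l + σ * ‖p‖ ^ m + lam * u x t ≤ f x ∨ (x ∈ frontier Ω ∧ u x t ≤ g x)

theorem HasJet.exists_test {S : Set (Euc N)} {φ : Euc N × ℝ → ℝ} {x p : Euc N} {t a l : ℝ}
    {u : Euc N → ℝ → ℝ} (hφ : HasJet φ x t a p l)
    (hmax : IsLocalMaxOn (fun X : Euc N × ℝ => u X.1 X.2 - φ X) (S ×ˢ Iic t) (x, t)) :
    ∃ ψ : Euc N × ℝ → ℝ, ContDiff ℝ 2 ψ ∧ HasJet ψ x t a p l ∧
      IsLocalMaxOn (fun X : Euc N × ℝ => u X.1 X.2 - ψ X) (S ×ˢ Iic t) (x, t) := by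
  obtain ⟨ψ, hψ, hψφ⟩ := hφ.exists_contDiff
  refine ⟨ψ, hψ, hφ.congr_of_eventuallyEq hψφ, ?_⟩
  filter_upwards [hmax, mem_nhdsWithin_of_mem_nhds hψφ] with X hX hX'
  rw [hX', hψφ.eq_of_nhds]
  exact hX

theorem nhdsWithin_prod_Iic_eq {S : Set (Euc N)} (x : Euc N) {t : ℝ} (ht : 0 < t) :
    𝓝[S ×ˢ Ioc 0 t] (x, t) = 𝓝[S ×ˢ Iic t] (x, t) := by
  rw [nhdsWithin_prod_eq, nhdsWithin_prod_eq]
  congr 1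
  rw [← Ioi_inter_Iic]
  exact nhdsWithin_inter_of_mem (mem_nhdsWithin_of_mem_nhds (Ioi_mem_nhds ht))

theorem mem_or_mem_frontier_of_mem_closure {Ω : Set (Euc N)} (hΩ : IsOpen Ω) {x : Euc N}
    (hx : x ∈ closure Ω) : x ∈ Ω ∨ x ∈ frontier Ω := by
  by_cases h : x ∈ Ω
  · exact Or.inl h
  · exact Or.inr (by rw [hΩ.frontier_eq]; exact ⟨hx, h⟩)

theorem IsParSub.visSub {Ω : Set (Euc N)} (hΩ : IsOpen Ω) {f g u₀ : Euc N → ℝ} {lam m : ℝ}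
    {u : Euc N → ℝ → ℝ} (hu : ∀ T > 0, IsParSub Ω f g u₀ lam m T u) :
    VisSub 1 Ω f g lam m u := by
  intro x hx t ht φ a p l hφ hmax
  obtain ⟨ψ, hψ, hjet, hmaxψ⟩ := hφ.exists_test hmax
  have h := (hu t ht).2.2 ψ hψ x t ⟨hx, ht, le_rfl⟩ (by
    rw [IsLocalMaxOn, nhdsWithin_prod_Iic_eq x ht]; exact hmaxψ)
  simp only [parOp, hjet.2.1, hjet.2.2.1, hjet.2.2.2] at h
  rcases mem_or_mem_frontier_of_mem_closure hΩ hx with hx' | hx'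
  · exact Or.inl (by linarith [h.1 hx'])
  · rcases min_le_iff.1 (h.2 hx') with h1 | h1
    · exact Or.inl (by linarith)
    · exact Or.inr ⟨hx', by linarith⟩

theorem IsParSuper.visSub {Ω : Set (Euc N)} (hΩ : IsOpen Ω) {f g u₀ : Euc N → ℝ} {lam m : ℝ}
    {u : Euc N → ℝ → ℝ} (hu : ∀ T > 0, IsParSuper Ω f g u₀ lam m T u) :
    VisSub (-1) Ω (fun x => - f x) (fun x => - g x) lam m (fun x t => - u x t) := by
  intro x hx t ht φ a p l hφ hmax
  obtain ⟨ψ, hψ, hjet, hmaxψ⟩ := hφ.exists_test (u := fun x t => - u x t) hmax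
  have h := (hu t ht).2.2 (fun X => - ψ X) hψ.neg x t ⟨hx, ht, le_rfl⟩ (by
    rw [IsLocalMinOn, nhdsWithin_prod_Iic_eq x ht]
    filter_upwards [hmaxψ] with X hX
    linarith)
  have hj := hjet.neg
  simp only [parOp, hj.2.1, hj.2.2.1, hj.2.2.2, norm_neg] at h
  rcases mem_or_mem_frontier_of_mem_closure hΩ hx with hx' | hx'
  · exact Or.inl (by linarith [h.1 hx'])
  · rcases le_max_iff.1 (h.2 hx') with h1 | h1
    · exact Or.inl (by linarith)
    · exact Or.inr ⟨hx', by linarith⟩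

theorem isLocalMaxOn_slice {S : Set (Euc N)} {w : Euc N → ℝ} {φ : Euc N × ℝ → ℝ} {x : Euc N}
    {t : ℝ} (hx : x ∈ S)
    (hmax : IsLocalMaxOn (fun X : Euc N × ℝ => w X.1 - φ X) (S ×ˢ Iic t) (x, t)) :
    IsLocalMaxOn (w - fun y => φ (y, t)) S x ∧ deriv (fun s => φ (x, s)) t ≤ 0 := by
  constructor
  · have : Tendsto (fun y : Euc N => (y, t)) (𝓝[S] x) (𝓝[S ×ˢ Iic t] (x, t)) :=
      tendsto_nhdsWithin_iff.2 ⟨(Continuous.prodMk_left t).continuousWithinAt,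
        eventually_nhdsWithin_of_forall fun y hy => ⟨hy, mem_Iic.2 le_rfl⟩⟩
    exact this.eventually hmax
  · have h1 : Tendsto (fun s : ℝ => (x, s)) (𝓝[Iic t] t) (𝓝[S ×ˢ Iic t] (x, t)) :=
      tendsto_nhdsWithin_iff.2 ⟨(Continuous.prodMk_right x).continuousWithinAt,
        eventually_nhdsWithin_of_forall fun s hs => ⟨hx, hs⟩⟩
    have h2 : IsLocalMaxOn (fun s => - φ (x, s)) (Iic t) t := by
      filter_upwards [h1.eventually hmax] with s hs
      linarith
    have h3 := deriv_nonneg_of_isLocalMaxOn_Iic h2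
    rw [deriv.fun_neg] at h3
    linarith

theorem IsStatSub.visSub {Ω : Set (Euc N)} (hΩ : IsOpen Ω) {f g : Euc N → ℝ} {lam m : ℝ}
    {w : Euc N → ℝ} (hw : IsStatSub Ω f g lam m w) :
    VisSub 1 Ω f g lam m (fun x _ => w x) := by
  intro x hx t ht φ a p l hφ hmax
  obtain ⟨ψ, hψ, hjet, hmaxψ⟩ := hφ.exists_test (u := fun x _ => w x) hmax
  obtain ⟨h1, h2⟩ := isLocalMaxOn_slice hx hmaxψ
  have h := hw.2 (fun y => ψ (y, t)) (hψ.comp (contDiff_id.prodMk contDiff_const)) x hx h1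
  simp only [statOp, hjet.2.2.1, hjet.2.2.2] at h
  rw [hjet.2.1] at h2
  rcases mem_or_mem_frontier_of_mem_closure hΩ hx with hx' | hx'
  · exact Or.inl (by linarith [h.1 hx'])
  · rcases min_le_iff.1 (h.2 hx') with h1 | h1
    · exact Or.inl (by linarith)
    · exact Or.inr ⟨hx', by linarith⟩

theorem IsStatSuper.visSub {Ω : Set (Euc N)} (hΩ : IsOpen Ω) {f g : Euc N → ℝ} {lam m : ℝ}
    {w : Euc N → ℝ} (hw : IsStatSuper Ω f g lam m w) :
    VisSub (-1) Ω (fun x => - f x) (fun x => - g x) lam m (fun x _ => - w x) := by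
  intro x hx t ht φ a p l hφ hmax
  obtain ⟨ψ, hψ, hjet, hmaxψ⟩ := hφ.exists_test (u := fun x _ => - w x) hmax
  obtain ⟨h1, h2⟩ := isLocalMaxOn_slice (w := fun x => - w x) hx hmaxψ
  have h := hw.2 (fun y => - ψ (y, t)) (hψ.comp (contDiff_id.prodMk contDiff_const)).neg x hx (by
    filter_upwards [h1] with X hX
    simp only [Pi.sub_apply] at hX ⊢
    linarith)
  have hj := hjet.neg
  simp only [statOp, hj.2.2.1, hj.2.2.2, norm_neg] at h
  rw [hjet.2.1] at h2
  rcases mem_or_mem_frontier_of_mem_closure hΩ hx with hx' | hx'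
  · exact Or.inl (by linarith [h.1 hx'])
  · rcases le_max_iff.1 (h.2 hx') with h1 | h1
    · exact Or.inl (by linarith)
    · exact Or.inr ⟨hx', by linarith⟩

theorem VisSub.shift {σ : ℝ} {Ω : Set (Euc N)} {f g : Euc N → ℝ} {lam m : ℝ} {u : Euc N → ℝ → ℝ}
    (hu : VisSub σ Ω f g lam m u) {s : ℝ} (hs : 0 ≤ s) :
    VisSub σ Ω f g lam m (fun x t => u x (t + s)) := by
  intro x hx t ht φ a p l hφ hmax
  have hφ' : HasJet (fun X : Euc N × ℝ => φ (X.1 - 0, X.2 - s)) x (t + s) a p l :=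
    HasJet.comp_sub (by simpa using hφ)
  refine hu x hx (t + s) (by linarith) _ a p l hφ' ?_
  have hT : Tendsto (fun X : Euc N × ℝ => (X.1 - 0, X.2 - s)) (𝓝[closure Ω ×ˢ Iic (t + s)] (x, t + s))
      (𝓝[closure Ω ×ˢ Iic t] (x, t)) := by
    refine tendsto_nhdsWithin_iff.2 ⟨?_, eventually_nhdsWithin_of_forall fun X hX => ?_⟩
    · have : Continuous fun X : Euc N × ℝ => (X.1 - 0, X.2 - s) := by fun_prop
      simpa using (this.tendsto (x, t + s)).mono_left nhdsWithin_le_nhds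
    · refine ⟨by simpa using hX.1, ?_⟩
      have := hX.2
      simp only [mem_Iic] at this ⊢
      linarith
  filter_upwards [hT.eventually hmax] with X hX
  simpa using hX

/-- The maximum of a continuous function on a cylinder, as a local maximum. -/
theorem isLocalMaxOn_of_isMaxOn_cylinder {S : Set (Euc N)} {h : Euc N × ℝ → ℝ} {x₀ x : Euc N}
    {t₀ t r : ℝ} (hmax : IsMaxOn h ((S ∩ closedBall x₀ r) ×ˢ Icc (t₀ - r) t₀) (x, t))
    (hx : ‖x - x₀‖ < r) (ht : t₀ - r < t) (ht' : t ≤ t₀) :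
    IsLocalMaxOn h (S ×ˢ Iic t) (x, t) := by
  have hn : (ball x₀ r ×ˢ Ioi (t₀ - r)) ∈ 𝓝 (x, t) :=
    prod_mem_nhds (isOpen_ball.mem_nhds (by simpa [dist_eq_norm] using hx)) (Ioi_mem_nhds ht)
  filter_upwards [mem_nhdsWithin_of_mem_nhds hn, self_mem_nhdsWithin] with X hX hX'
  exact hmax ⟨⟨hX'.1, ball_subset_closedBall hX.1⟩, le_of_lt hX.2, le_trans hX'.2 ht'⟩

theorem VisSub.le_of_initial_le {σ : ℝ} {Ω : Set (Euc N)} (hΩb : Bornology.IsBounded Ω)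
    {f g : Euc N → ℝ} {lam m : ℝ} (hm : 1 < m) (hlam : 0 < lam) {u : Euc N → ℝ → ℝ}
    (hu : VisSub σ Ω f g lam m u)
    (hc : ContinuousOn (fun X : Euc N × ℝ => u X.1 X.2) (closure Ω ×ˢ Ici 0)) {C : ℝ}
    (h0 : ∀ x ∈ closure Ω, u x 0 ≤ C) (hf : ∀ x ∈ closure Ω, f x ≤ lam * C)
    (hg : ∀ x ∈ frontier Ω, g x ≤ C) : ∀ x ∈ closure Ω, ∀ t, 0 ≤ t → u x t ≤ C := by
  intro x hx T hT
  have hK : IsCompact (closure Ω ×ˢ Icc 0 T) := hΩb.isCompact_closure.prod isCompact_Icc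
  obtain ⟨⟨y, t⟩, ⟨hy, ht⟩, hmax⟩ := hK.exists_isMaxOn ⟨(x, T), hx, hT, le_rfl⟩
    (hc.mono (prod_mono_right fun t ht => ht.1))
  have hle : u x T ≤ u y t := hmax (a := (x, T)) ⟨hx, hT, le_rfl⟩
  refine hle.trans ?_
  rcases ht.1.eq_or_lt with h | h
  · exact (congrArg (u y) h.symm).trans_le (h0 y hy)
  · have hj : HasJet (fun _ : Euc N × ℝ => (0 : ℝ)) y t 0 0 0 := by
      simpa using HasJet.of_snd (x := y) (t := t) (θ := fun _ => (0 : ℝ)) contDiffAt_const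
    have hloc : IsLocalMaxOn (fun X : Euc N × ℝ => u X.1 X.2 - 0) (closure Ω ×ˢ Iic t) (y, t) := by
      filter_upwards [self_mem_nhdsWithin,
        mem_nhdsWithin_of_mem_nhds (prod_mem_nhds univ_mem (Ioi_mem_nhds h))] with X hX hX'
      have := hmax (a := X) ⟨hX.1, le_of_lt hX'.2, le_trans hX.2 ht.2⟩
      simpa using this
    rcases hu y hy t h _ _ _ _ hj hloc with h1 | h1
    · simp only [norm_zero, Real.zero_rpow (by linarith : m ≠ 0), mul_zero, sub_zero, zero_add]
        at h1
      exact le_of_mul_le_mul_left (h1.trans (hf y hy)) hlam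
    · exact h1.2.trans (hg y h1.1)

end ViscositySub

section BoundaryInequality

variable {N : ℕ}

theorem hasJet_sq_norm_sub_add_sq (x₀ x : Euc N) (t₀ t : ℝ) :
    HasJet (fun X : Euc N × ℝ => ‖X.1 - x₀‖ ^ 2 + (X.2 - t₀) ^ 2) x t (2 * (t - t₀))
      ((2 : ℝ) • (x - x₀)) (2 * N) := by
  have h1 := HasJet.of_fst (t := t) (contDiff_sq_norm_sub x₀).contDiffAt (x := x)
  have h2 : HasJet (fun X : Euc N × ℝ => (X.2 - t₀) ^ 2) x t (2 * (t - t₀)) 0 0 := by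
    refine (HasJet.of_snd (x := x) (t := t) (θ := fun s => (s - t₀) ^ 2)
      (ContDiff.contDiffAt (by fun_prop))).congr_val ?_ rfl rfl
    simp
  refine (h1.add h2).congr_val (by simp) ?_ ?_
  · rw [gradient_sq_norm_sub, add_zero]
  · rw [lapl_sq_norm_sub, add_zero]

theorem exists_mul_add_lt_rpow {m : ℝ} (hm : 1 < m) {γ : ℝ} (hγ : 0 < γ) (D E K₀ : ℝ) :
    ∃ K, K₀ ≤ K ∧ 1 ≤ K ∧ K * D + E < (K * γ) ^ m := by
  have h1 : Tendsto (fun K : ℝ => K ^ (m - 1) * γ ^ m) atTop atTop :=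
    (tendsto_rpow_atTop (by linarith)).atTop_mul_const (Real.rpow_pos_of_pos hγ m)
  obtain ⟨K, h2, h3, h4⟩ := ((h1.eventually_gt_atTop (D + |E|)).and
    ((eventually_ge_atTop K₀).and (eventually_ge_atTop 1))).exists
  refine ⟨K, h3, h4, ?_⟩
  have hK : 0 < K := by linarith
  have h5 : (K * γ) ^ m = K * (K ^ (m - 1) * γ ^ m) := by
    rw [Real.mul_rpow hK.le hγ.le, ← mul_assoc, Real.rpow_sub_one hK.ne', mul_div_cancel₀ _ hK.ne']
  rw [h5]
  have h6 : K * (D + |E|) < K * (K ^ (m - 1) * γ ^ m) := mul_lt_mul_of_pos_left h2 hK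
  have h7 : |E| ≤ K * |E| := le_mul_of_one_le_left (abs_nonneg E) h4
  linarith [le_abs_self E]

theorem ContinuousOn.exists_abs_le_of_isCompact {X : Type*} [TopologicalSpace X] {K : Set X}
    {h : X → ℝ} (hh : ContinuousOn h K) (hK : IsCompact K) : ∃ C > 0, ∀ x ∈ K, |h x| ≤ C := by
  obtain ⟨C, hC⟩ := hK.exists_bound_of_continuousOn hh
  exact ⟨max C 1, by positivity, fun x hx => (hC x hx).trans (le_max_left _ _)⟩

theorem ContinuousAt.exists_closedBall {X : Type*} [PseudoMetricSpace X] {P : X → Prop} {x : X}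
    (h : ∀ᶠ y in 𝓝 x, P y) : ∃ r > 0, ∀ y ∈ closedBall x r, P y :=
  Metric.nhds_basis_closedBall.eventually_iff.1 h

theorem HasC2Boundary.exists_nonpos_on_closure {Ω : Set (Euc N)} (hΩ : HasC2Boundary Ω) :
    ∃ ρ : Euc N → ℝ, ContDiff ℝ 2 ρ ∧ Ω = {x | ρ x < 0} ∧
      (∀ x ∈ frontier Ω, ρ x = 0 ∧ gradient ρ x ≠ 0) ∧ ∀ x ∈ closure Ω, ρ x ≤ 0 := by
  obtain ⟨ρ, hρ, hρΩ, hρfr, hρgrad⟩ := hΩ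
  refine ⟨ρ, hρ, hρΩ, fun x hx => ⟨?_, hρgrad x hx⟩, fun x hx => ?_⟩
  · rw [hρfr] at hx
    exact hx
  · have : closure Ω ⊆ {x | ρ x ≤ 0} :=
      closure_minimal (by rw [hρΩ]; exact ofPred_subset_ofPred.2 fun y hy => hy.le)
        (isClosed_le hρ.continuous continuous_const)
    exact this hx

theorem VisSub.le_boundary {Ω : Set (Euc N)} (hΩb : Bornology.IsBounded Ω)
    (hΩ2 : HasC2Boundary Ω) {f g : Euc N → ℝ} {lam m : ℝ} (hm : 1 < m) (hlam : 0 < lam)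
    (hf : ContinuousOn f (closure Ω)) (hg : ContinuousOn g (frontier Ω)) {u : Euc N → ℝ → ℝ}
    (hu : VisSub 1 Ω f g lam m u)
    (hc : ContinuousOn (fun X : Euc N × ℝ => u X.1 X.2) (closure Ω ×ˢ Ici 0)) :
    ∀ x ∈ frontier Ω, ∀ t > 0, u x t ≤ g x := by
  intro x₀ hx₀ t₀ ht₀
  by_contra! hlt
  obtain ⟨ρ, hρ, -, hρfr, hρcl⟩ := hΩ2.exists_nonpos_on_closure
  have hfrcl : frontier Ω ⊆ closure Ω := frontier_subset_closure
  have hρ0 : ρ x₀ = 0 := (hρfr x₀ hx₀).1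
  obtain ⟨F, -, hF⟩ := hf.exists_abs_le_of_isCompact hΩb.isCompact_closure
  obtain ⟨M, hM0, hM⟩ := (hc.mono (prod_mono_right Icc_subset_Ici_self)
    ).exists_abs_le_of_isCompact (hΩb.isCompact_closure.prod (isCompact_Icc (a := 0) (b := t₀)))
  have hgrad0 : 0 < ‖gradient ρ x₀‖ := norm_pos_iff.2 (hρfr x₀ hx₀).2
  set γ := ‖gradient ρ x₀‖ / 2 with hγ
  set D := |lapl ρ x₀| + 1 with hD
  have hgood : ∀ᶠ X : Euc N × ℝ in 𝓝 (x₀, t₀), γ ≤ ‖gradient ρ X.1‖ ∧ |lapl ρ X.1| ≤ D ∧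
      0 < X.2 ∧ (X.1 ∈ frontier Ω → g X.1 < u X.1 X.2) := by
    refine ((hρ.continuous_gradient.norm.comp continuous_fst).tendsto (x₀, t₀) |>.eventually
      (le_mem_nhds (by simp only [hγ, Function.comp]; linarith))).and
      (((hρ.continuous_lapl.abs.comp continuous_fst).tendsto (x₀, t₀) |>.eventually
      (ge_mem_nhds (by simp [hD]))).and (((continuous_snd.tendsto (x₀, t₀)).eventually
      (lt_mem_nhds ht₀)).and ?_))
    have h1 : ContinuousWithinAt (fun X : Euc N × ℝ => u X.1 X.2 - g X.1)
        (frontier Ω ×ˢ Ici 0) (x₀, t₀) := by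
      refine ((hc.mono (prod_mono_left hfrcl)) (x₀, t₀) ⟨hx₀, ht₀.le⟩).sub ?_
      exact (hg x₀ hx₀).comp continuous_fst.continuousWithinAt fun X hX => hX.1
    have h2 := h1.eventually (lt_mem_nhds (a := 0) (by simpa using hlt))
    rw [eventually_nhdsWithin_iff] at h2
    filter_upwards [h2, (continuous_snd.tendsto (x₀, t₀)).eventually (lt_mem_nhds ht₀)]
      with X hX hX' hfr
    linarith [hX ⟨hfr, le_of_lt hX'⟩]
  obtain ⟨r, hr, hgood⟩ := ContinuousAt.exists_closedBall hgood
  replace hgood : ∀ x t, ‖x - x₀‖ ≤ r → t ∈ Icc (t₀ - r) t₀ → γ ≤ ‖gradient ρ x‖ ∧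
      |lapl ρ x| ≤ D ∧ 0 < t ∧ (x ∈ frontier Ω → g x < u x t) := fun x t hx ht => by
    refine hgood (x, t) ?_
    rw [mem_closedBall, Prod.dist_eq, max_le_iff]
    refine ⟨by simpa [dist_eq_norm] using hx, ?_⟩
    rw [Real.dist_eq, abs_le]
    constructor <;> linarith [ht.1, ht.2]
  have hγ0 : 0 < γ := by positivity
  set c := (2 * M + 1) / r ^ 2 with hcdef
  have hc0 : 0 < c := by positivity
  have hcr : c * r ^ 2 = 2 * M + 1 := by rw [hcdef]; field_simp
  obtain ⟨K, hK1, hK2, hK3⟩ := exists_mul_add_lt_rpow hm (half_pos hγ0) D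
    (2 * c * r + c * (2 * N) + lam * M + F) (4 * c * r / γ)
  have hK0 : 0 < K := by linarith
  have hcpt : IsCompact ((closure Ω ∩ closedBall x₀ r) ×ˢ Icc (t₀ - r) t₀) :=
    (hΩb.isCompact_closure.inter_right isClosed_closedBall).prod isCompact_Icc
  have hmem : (x₀, t₀) ∈ (closure Ω ∩ closedBall x₀ r) ×ˢ Icc (t₀ - r) t₀ :=
    ⟨⟨hfrcl hx₀, mem_closedBall_self hr.le⟩, by linarith, le_rfl⟩
  have hpos : ∀ X ∈ (closure Ω ∩ closedBall x₀ r) ×ˢ Icc (t₀ - r) t₀, 0 < X.2 :=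
    fun X hX => (hgood X.1 X.2 (by simpa [dist_eq_norm] using hX.1.2) hX.2).2.2.1
  have hcont : ContinuousOn (fun X : Euc N × ℝ => u X.1 X.2 -
      (c * (‖X.1 - x₀‖ ^ 2 + (X.2 - t₀) ^ 2) + (-K) * ρ X.1))
      ((closure Ω ∩ closedBall x₀ r) ×ˢ Icc (t₀ - r) t₀) := by
    refine (hc.mono fun X hX => ⟨hX.1.1, (hpos X hX).le⟩).sub (Continuous.continuousOn ?_)
    have := hρ.continuous
    fun_prop
  obtain ⟨⟨x, t⟩, hX, hmax⟩ := hcpt.exists_isMaxOn ⟨_, hmem⟩ hcont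
  have hxr : ‖x - x₀‖ ≤ r := by simpa [dist_eq_norm] using hX.1.2
  obtain ⟨h1, h2, h3, h4⟩ := hgood x t hxr hX.2
  have hxcl : x ∈ closure Ω := hX.1.1
  have hut : |u x t| ≤ M := hM (x, t) ⟨hxcl, h3.le, hX.2.2⟩
  have hut₀ : |u x₀ t₀| ≤ M := hM (x₀, t₀) ⟨hfrcl hx₀, ht₀.le, le_rfl⟩
  have hle := hmax hmem
  simp only [mem_ofPred_eq, sub_self, norm_zero, hρ0] at hle
  have hsum : c * (‖x - x₀‖ ^ 2 + (t - t₀) ^ 2) ≤ 2 * M := by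
    have := mul_nonneg hK0.le (neg_nonneg.2 (hρcl x hxcl))
    rw [abs_le] at hut hut₀
    simp at hle
    linarith
  have hsmall : ‖x - x₀‖ ^ 2 + (t - t₀) ^ 2 < r ^ 2 := by
    by_contra! h
    have := mul_le_mul_of_nonneg_left h hc0.le
    linarith
  have hxr' : ‖x - x₀‖ < r := lt_of_pow_lt_pow_left₀ 2 hr.le (by nlinarith [sq_nonneg (t - t₀)])
  have htr : t₀ - r < t := by
    have : |t - t₀| < r := abs_lt_of_sq_lt_sq (by nlinarith [sq_nonneg ‖x - x₀‖]) hr.le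
    linarith [(abs_lt.1 this).1]
  have hj := ((hasJet_sq_norm_sub_add_sq x₀ x t₀ t).const_mul c).add
    ((HasJet.of_fst (t := t) (hρ.contDiffAt (x := x))).const_mul (-K))
  rcases hu x hxcl t h3 _ _ _ _ hj (isLocalMaxOn_of_isMaxOn_cylinder hmax hxr' htr hX.2.2)
    with h | h
  · have hp : K * (γ / 2) ≤ ‖c • (2 : ℝ) • (x - x₀) + (-K) • gradient ρ x‖ := by
      have e1 : ‖(-K) • gradient ρ x‖ = K * ‖gradient ρ x‖ := by
        rw [norm_smul, norm_neg, Real.norm_of_nonneg hK0.le]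
      have e2 : ‖c • (2 : ℝ) • (x - x₀)‖ = c * (2 * ‖x - x₀‖) := by
        rw [norm_smul, norm_smul, Real.norm_of_nonneg hc0.le]; norm_num
      have e3 := norm_sub_norm_le ((-K) • gradient ρ x) (-(c • (2 : ℝ) • (x - x₀)))
      rw [norm_neg, sub_neg_eq_add, e1, e2, add_comm ((-K) • _)] at e3
      have e4 : K * γ ≤ K * ‖gradient ρ x‖ := mul_le_mul_of_nonneg_left h1 hK0.le
      have e5 : 4 * c * r ≤ K * γ := by rwa [div_le_iff₀ hγ0] at hK1
      have e6 : c * ‖x - x₀‖ ≤ c * r := mul_le_mul_of_nonneg_left hxr hc0.le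
      linarith
    have hp' := Real.rpow_le_rpow (by positivity) hp (by linarith : 0 ≤ m)
    have hL : -(K * D) ≤ K * lapl ρ x := by
      have := mul_le_mul_of_nonneg_left (neg_le_of_abs_le h2) hK0.le
      linarith
    have hu' := mul_le_mul_of_nonneg_left (neg_le_of_abs_le hut) hlam.le
    have hf' := le_of_abs_le (hF x hxcl)
    have ht' : -(c * r) ≤ c * (t - t₀) := by
      have := mul_le_mul_of_nonneg_left (show -r ≤ t - t₀ by linarith) hc0.le
      linarith
    linarith
  · exact absurd h.2 (not_le.2 (h4 h.1))

end BoundaryInequality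

section Regularization

variable {N : ℕ}

theorem exists_inward_cone {Ω : Set (Euc N)} (hΩo : IsOpen Ω) (hΩ2 : HasC2Boundary Ω)
    {x₀ : Euc N} (hx₀ : x₀ ∈ closure Ω) :
    ∃ n : Euc N, ∃ r > 0, ∃ c > 0, ∃ δ₀ > 0, ∀ x ∈ closure Ω, ‖x - x₀‖ ≤ r →
      ∀ δ, 0 < δ → δ ≤ δ₀ → closedBall (x + δ • n) (c * δ) ⊆ Ω := by
  rcases mem_or_mem_frontier_of_mem_closure hΩo hx₀ with h | h
  · obtain ⟨r, hr, hball⟩ := Metric.nhds_basis_closedBall.mem_iff.1 (hΩo.mem_nhds h)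
    refine ⟨0, r / 2, half_pos hr, 1, one_pos, r / 2, half_pos hr, fun x _ hx δ _ hδ y hy => ?_⟩
    refine hball ?_
    rw [smul_zero, add_zero, one_mul, mem_closedBall] at hy
    rw [← dist_eq_norm] at hx
    exact (dist_triangle y x x₀).trans (by linarith)
  · have hcl := HasC2Boundary.exists_nonpos_on_closure hΩ2
    obtain ⟨ρ, hρ, hρΩ, hρgrad, hρcl⟩ := hcl
    set q := gradient ρ x₀ with hq
    have hq0 : 0 < ‖q‖ := norm_pos_iff.2 (hρgrad x₀ h).2
    have hst : HasStrictFDerivAt ρ (fderiv ℝ ρ x₀) x₀ :=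
      hρ.contDiffAt.hasStrictFDerivAt (by norm_num)
    have hlo := hst.isLittleO.def (c := ‖q‖ / 4) (by positivity)
    obtain ⟨r, hr, hball⟩ := Metric.nhds_basis_closedBall.eventually_iff.1 hlo
    refine ⟨-q, r / 2, half_pos hr, ‖q‖ / 4, by positivity, r / (4 * ‖q‖), by positivity,
      fun x hx hxr δ hδ hδ₀ y hy => ?_⟩
    set z := y - (x + δ • -q) with hz
    have hznorm : ‖z‖ ≤ ‖q‖ / 4 * δ := by rwa [mem_closedBall, dist_eq_norm] at hy
    have hyx : y - x = z - δ • q := by rw [hz, smul_neg]; abel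
    have hyxn : ‖y - x‖ ≤ 5 / 4 * ‖q‖ * δ := by
      rw [hyx]
      refine (norm_sub_le _ _).trans ?_
      rw [norm_smul, Real.norm_of_nonneg hδ.le]
      linarith
    have hδq : ‖q‖ * δ ≤ r / 4 := by
      rw [le_div_iff₀ (by positivity)] at hδ₀
      linarith
    have hmem : ((y, x) : Euc N × Euc N) ∈ closedBall (x₀, x₀) r := by
      rw [mem_closedBall, Prod.dist_eq, max_le_iff]
      refine ⟨(dist_triangle y x x₀).trans ?_, ?_⟩
      · rw [dist_eq_norm, dist_eq_norm]
        linarith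
      · change dist x x₀ ≤ r
        rw [dist_eq_norm]
        linarith
    have h1 := hball hmem
    have h2 : fderiv ℝ ρ x₀ (y - x) = inner ℝ q (y - x) := by
      rw [hq, inner_gradient_left]
    have h3 : inner ℝ q (y - x) ≤ ‖q‖ * (‖q‖ / 4 * δ) - δ * ‖q‖ ^ 2 := by
      rw [hyx, inner_sub_right, inner_smul_right, real_inner_self_eq_norm_sq]
      have := (real_inner_le_norm q z).trans (mul_le_mul_of_nonneg_left hznorm hq0.le)
      linarith
    rw [Real.norm_eq_abs] at h1
    have h4 := le_of_abs_le h1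
    simp only [h2] at h4
    have h5 : ‖q‖ / 4 * ‖y - x‖ ≤ ‖q‖ / 4 * (5 / 4 * ‖q‖ * δ) :=
      mul_le_mul_of_nonneg_left hyxn (by positivity)
    have h6 : 0 < ‖q‖ ^ 2 * δ := by positivity
    rw [hρΩ, mem_ofPred_eq]
    have := hρcl x hx
    nlinarith

theorem ContinuousOn.exists_extension {E : Type*} [MetricSpace E] [ProperSpace E] {K : Set E}
    (hK : IsCompact K) {h : E → ℝ} (hh : ContinuousOn h K) :
    ∃ v : E → ℝ, Continuous v ∧ HasCompactSupport v ∧ EqOn v h K := by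
  obtain ⟨w, hw⟩ := ContinuousMap.exists_restrict_eq hK.isClosed
    (⟨K.domRestrict h, hh.domRestrict⟩ : C(K, ℝ))
  obtain ⟨χ, hχ1, -, hχc, -⟩ := exists_continuous_one_zero_of_isCompact hK isClosed_empty
    (disjoint_empty K)
  refine ⟨fun x => χ x * w x, by fun_prop, hχc.mul_right, fun x hx => ?_⟩
  have : w x = h x := DFunLike.congr_fun hw ⟨x, hx⟩
  simp [this, hχ1 hx]

theorem abs_mollify_sub_le {ρ v : Euc N × ℝ → ℝ} (hρ : Continuous ρ) (hρc : HasCompactSupport ρ)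
    (hρ0 : ∀ Y, 0 ≤ ρ Y) (hρ1 : ∫ Y, ρ Y = 1) (hv : Continuous v) {X : Euc N × ℝ} {c ε : ℝ}
    (h : ∀ Y ∈ tsupport ρ, |v (X - Y) - c| ≤ ε) : |mollify ρ v X - c| ≤ ε := by
  have hρi : Integrable ρ := hρ.integrable_of_hasCompactSupport hρc
  have e : mollify ρ v X - c = ∫ Y, ρ Y * (v (X - Y) - c) := by
    simp only [mul_sub]
    rw [integral_sub (integrable_mul_of_hasCompactSupport hρ hρc (by fun_prop))
      (hρi.mul_const c), integral_mul_const, hρ1, one_mul, mollify]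
  have e2 : ε = ∫ Y, ρ Y * ε := by rw [integral_mul_const, hρ1, one_mul]
  rw [e, e2, ← Real.norm_eq_abs]
  refine norm_integral_le_of_norm_le (hρi.mul_const ε) (Eventually.of_forall fun Y => ?_)
  rw [norm_mul, Real.norm_of_nonneg (hρ0 Y)]
  by_cases hY : Y ∈ tsupport ρ
  · exact mul_le_mul_of_nonneg_left (h Y hY) (hρ0 Y)
  · simp [image_eq_zero_of_notMem_tsupport hY]

theorem exists_mollifier {η : ℝ} (hη : 0 < η) : ∃ ρ : Euc N × ℝ → ℝ, ContDiff ℝ 2 ρ ∧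
    HasCompactSupport ρ ∧ (∀ Y, 0 ≤ ρ Y) ∧ ∫ Y, ρ Y = 1 ∧ ∀ Y ∈ tsupport ρ, ‖Y‖ ≤ η := by
  have : (volume : Measure (Euc N × ℝ)).IsAddHaarMeasure :=
    inferInstanceAs ((volume : Measure (Euc N)).prod (volume : Measure ℝ)).IsAddHaarMeasure
  let χ : ContDiffBump (0 : Euc N × ℝ) := ⟨η / 2, η, half_pos hη, half_lt_self hη⟩
  refine ⟨χ.normed volume, χ.contDiff_normed (n := 2), χ.hasCompactSupport_normed,
    χ.nonneg_normed, χ.integral_normed, fun Y hY => ?_⟩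
  rw [χ.tsupport_normed_eq] at hY
  simpa using hY

/-- Inward translation and mollification of a subsolution near a point of the closed domain. -/
theorem VisSub.exists_regularization {Ω : Set (Euc N)} (hΩo : IsOpen Ω)
    (hΩb : Bornology.IsBounded Ω) (hΩ2 : HasC2Boundary Ω) {f g : Euc N → ℝ} {lam m : ℝ}
    (hm : 1 < m) (hf : ContinuousOn f (closure Ω)) {u : Euc N → ℝ → ℝ}
    (hu : VisSub 1 Ω f g lam m u)
    (hc : ContinuousOn (fun X : Euc N × ℝ => u X.1 X.2) (closure Ω ×ˢ Ici 0))
    {x₀ : Euc N} {t₀ : ℝ} (hx₀ : x₀ ∈ closure Ω) (ht₀ : 0 < t₀) :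
    ∃ r > 0, ∀ ε > 0, ∃ U : Euc N × ℝ → ℝ, Continuous U ∧ ∀ x ∈ closure Ω, ‖x - x₀‖ ≤ r →
      ∀ t ∈ Icc (t₀ - r) t₀, |U (x, t) - u x t| ≤ ε ∧ ∃ a p l, HasJet U x t a p l ∧
        a - l + ‖p‖ ^ m + lam * U (x, t) ≤ f x + ε := by
  obtain ⟨n, r, hr, c, hc0, δ₀, hδ₀, hcone⟩ := exists_inward_cone hΩo hΩ2 hx₀
  have hK : IsCompact (closure Ω ×ˢ Icc 0 (t₀ + 1)) := hΩb.isCompact_closure.prod isCompact_Icc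
  obtain ⟨v, hv, hvc, hvu⟩ := (hc.mono (prod_mono_right Icc_subset_Ici_self)).exists_extension hK
  obtain ⟨F, hF, hFc, hFf⟩ := hf.exists_extension hΩb.isCompact_closure
  refine ⟨min r (t₀ / 2), by positivity, fun ε hε => ?_⟩
  obtain ⟨κ₁, hκ₁, hvκ⟩ := Metric.uniformContinuous_iff.1
    (hv.uniformContinuous_of_tendsto_cocompact hvc.is_zero_at_infty) ε hε
  obtain ⟨κ₂, hκ₂, hFκ⟩ := Metric.uniformContinuous_iff.1
    (hF.uniformContinuous_of_tendsto_cocompact hFc.is_zero_at_infty) ε hε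
  set κ := min κ₁ κ₂ with hκ
  have hκ0 : 0 < κ := by positivity
  set δ := min δ₀ (κ / (2 * (‖n‖ + 1))) with hδ
  have hδ0 : 0 < δ := by positivity
  have hδκ : δ * (‖n‖ + 1) ≤ κ / 2 := by
    have : δ ≤ κ / (2 * (‖n‖ + 1)) := min_le_right _ _
    rw [le_div_iff₀ (by positivity)] at this
    linarith
  set η := min (min (c * δ) δ) (min (t₀ / 4) (1 / 2)) with hη
  have hη0 : 0 < η := by positivity
  have hη1 : η ≤ c * δ := (min_le_left _ _).trans (min_le_left _ _)
  have hη2 : η ≤ δ := (min_le_left _ _).trans (min_le_right _ _)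
  have hη3 : η ≤ t₀ / 4 := (min_le_right _ _).trans (min_le_left _ _)
  have hη4 : η ≤ 1 / 2 := (min_le_right _ _).trans (min_le_right _ _)
  obtain ⟨ρ, hρ, hρc, hρ0, hρ1, hρη⟩ := exists_mollifier (N := N) hη0
  have hmol := contDiff_mollify hρ hρc hv
  refine ⟨fun X => mollify ρ v (X.1 - -(δ • n), X.2 - 0),
    hmol.continuous.comp (by fun_prop), fun x hx hxr t ht => ?_⟩
  have hr' : min r (t₀ / 2) ≤ t₀ / 2 := min_le_right _ _
  have hdist : ∀ Y ∈ tsupport ρ, ‖(x - -(δ • n), t - 0) - Y - (x, t)‖ < κ := fun Y hY => by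
    have e : (x - -(δ • n), t - 0) - Y - (x, t) = (δ • n, (0 : ℝ)) - Y := by
      ext1 <;> simp
      abel
    rw [e]
    refine (norm_sub_le _ _).trans_lt ?_
    have e1 : ‖((δ • n, 0) : Euc N × ℝ)‖ = δ * ‖n‖ := by
      rw [Prod.norm_def]
      simp [norm_smul, abs_of_pos hδ0]
      positivity
    have := hρη Y hY
    rw [e1]
    linarith
  have hin : ∀ Y ∈ tsupport ρ, (x - -(δ • n), t - 0) - Y ∈ Ω ×ˢ Ioo 0 (t₀ + 1) := fun Y hY => by
    have hY' := hρη Y hY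
    have h1 : ‖Y.1‖ ≤ η := (norm_fst_le Y).trans hY'
    have h2 : |Y.2| ≤ η := (norm_snd_le Y).trans hY'
    rw [abs_le] at h2
    refine ⟨hcone x hx (hxr.trans (min_le_left _ _)) δ hδ0 (min_le_left _ _) ?_, ?_, ?_⟩
    · rw [mem_closedBall, dist_eq_norm]
      simpa using h1.trans hη1
    · change 0 < t - 0 - Y.2
      linarith [ht.1, ht.2, h2.1, h2.2]
    · change t - 0 - Y.2 < t₀ + 1
      linarith [ht.1, ht.2, h2.1, h2.2]
  have htK : t ∈ Icc 0 (t₀ + 1) := ⟨by linarith [ht.1], by linarith [ht.2]⟩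
  constructor
  · rw [show u x t = v (x, t) from (hvu (x := (x, t)) ⟨hx, htK⟩).symm]
    refine abs_mollify_sub_le hρ.continuous hρc hρ0 hρ1 hv fun Y hY => ?_
    have := hvκ (a := (x - -(δ • n), t - 0) - Y) (b := (x, t))
      (by rw [dist_eq_norm]; exact (hdist Y hY).trans_le (min_le_left _ _))
    rw [Real.dist_eq] at this
    exact this.le
  · have hj := (hmol.contDiffAt (x := (x - -(δ • n), t - 0))).hasJet
    refine ⟨_, _, _, hj.comp_sub, ?_⟩
    have hle := mollify_hamilton_le (lam := lam) hm hv hvc hF hρ hρc hρ0 hρ1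
      (hΩo.prod isOpen_Ioo) hin (fun y s hys φ a p l hφ hmax => ?_) hj
    · refine hle.trans ?_
      have h1 : |mollify ρ (fun X => F X.1) (x - -(δ • n), t - 0) - f x| ≤ ε := by
        rw [← hFf hx]
        refine abs_mollify_sub_le hρ.continuous hρc hρ0 hρ1 (hF.comp continuous_fst)
          fun Y hY => ?_
        have := hFκ (a := ((x - -(δ • n), t - 0) - Y).1) (b := x) (by
          rw [dist_eq_norm]
          exact ((norm_fst_le _).trans_lt (hdist Y hY)).trans_le (min_le_right _ _))
        rw [Real.dist_eq] at this
        exact this.le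
      linarith [le_of_abs_le h1]
    · have hys' : (y, s) ∈ closure Ω ×ˢ Icc 0 (t₀ + 1) :=
        ⟨subset_closure hys.1, Ioo_subset_Icc_self hys.2⟩
      have hvy : v (y, s) = u y s := hvu hys'
      have hnear : ∀ᶠ X in 𝓝 (y, s), v X = u X.1 X.2 := by
        filter_upwards [(hΩo.prod isOpen_Ioo).mem_nhds hys] with X hX
        exact hvu ⟨subset_closure hX.1, Ioo_subset_Icc_self hX.2⟩
      have hmax' : IsLocalMaxOn (fun X : Euc N × ℝ => u X.1 X.2 - φ X) (closure Ω ×ˢ Iic s)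
          (y, s) := by
        filter_upwards [nhdsWithin_mono _ (prod_mono_left (subset_univ (closure Ω))) hmax,
          mem_nhdsWithin_of_mem_nhds hnear] with X hX hX'
        rw [hX', hvy] at hX
        exact hX
      rw [hvy, hFf (subset_closure hys.1)]
      rcases hu y (subset_closure hys.1) s hys.2.1 φ a p l hφ hmax' with h | h
      · linarith
      · exact absurd hys.1 (hΩo.frontier_eq ▸ h.1).2

end Regularization

section Comparison

variable {N : ℕ}

theorem hasJet_exp (x : Euc N) (t M lam : ℝ) :
    HasJet (fun X : Euc N × ℝ => M * Real.exp (-(lam * X.2))) x t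
      (-(lam * (M * Real.exp (-(lam * t))))) 0 0 := by
  refine (HasJet.of_snd (x := x) (t := t) (θ := fun s => M * Real.exp (-(lam * s)))
    (ContDiff.contDiffAt (by fun_prop))).congr_val ?_ rfl rfl
  have h : HasDerivAt (fun s => M * Real.exp (-(lam * s)))
      (M * (Real.exp (-(lam * t)) * -(lam * 1))) t :=
    ((hasDerivAt_id t).const_mul lam).fun_neg.exp.const_mul M
  rw [h.deriv]
  ring

set_option maxHeartbeats 800000 in
/-- Comparison of a subsolution `u` with a supersolution `-w`, both continuous up to the
boundary; the difference of the initial data decays exponentially. -/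
theorem VisSub.comparison {Ω : Set (Euc N)} (hΩo : IsOpen Ω)
    (hΩb : Bornology.IsBounded Ω) (hΩ2 : HasC2Boundary Ω) {f g : Euc N → ℝ} {lam m : ℝ}
    (hm : 1 < m) (hlam : 0 < lam) (hf : ContinuousOn f (closure Ω))
    (hg : ContinuousOn g (frontier Ω)) {u w : Euc N → ℝ → ℝ}
    (hu : VisSub 1 Ω f g lam m u)
    (hw : VisSub (-1) Ω (fun x => - f x) (fun x => - g x) lam m w)
    (hcu : ContinuousOn (fun X : Euc N × ℝ => u X.1 X.2) (closure Ω ×ˢ Ici 0))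
    (hcw : ContinuousOn (fun X : Euc N × ℝ => w X.1 X.2) (closure Ω ×ˢ Ici 0))
    {M₀ : ℝ} (hM₀ : 0 ≤ M₀) (h0 : ∀ x ∈ closure Ω, u x 0 + w x 0 ≤ M₀) :
    ∀ x ∈ closure Ω, ∀ t, 0 ≤ t → u x t + w x t ≤ M₀ * Real.exp (-(lam * t)) := by
  intro x₁ hx₁ T hT
  by_contra! hlt
  have hsub : closure Ω ×ˢ Icc 0 T ⊆ closure Ω ×ˢ Ici 0 := prod_mono_right Icc_subset_Ici_self
  have hK : IsCompact (closure Ω ×ˢ Icc 0 T) := hΩb.isCompact_closure.prod isCompact_Icc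
  have hexp : Continuous fun X : Euc N × ℝ => M₀ * Real.exp (-(lam * X.2)) := by fun_prop
  obtain ⟨⟨x₀, t₀⟩, ⟨hx₀, ht₀⟩, hmax⟩ := hK.exists_isMaxOn ⟨(x₁, T), hx₁, hT, le_rfl⟩
    (((hcu.mono hsub).add (hcw.mono hsub)).sub hexp.continuousOn)
  replace hmax : ∀ x ∈ closure Ω, ∀ t ∈ Icc 0 T, u x t + w x t - M₀ * Real.exp (-(lam * t)) ≤
      u x₀ t₀ + w x₀ t₀ - M₀ * Real.exp (-(lam * t₀)) := fun x hx t ht => hmax (a := (x, t)) ⟨hx, ht⟩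
  set σ := u x₀ t₀ + w x₀ t₀ - M₀ * Real.exp (-(lam * t₀)) with hσ
  have hσ0 : 0 < σ := by linarith [hmax x₁ hx₁ T ⟨hT, le_rfl⟩]
  replace hx₀ : x₀ ∈ closure Ω := hx₀
  replace ht₀ : 0 ≤ t₀ ∧ t₀ ≤ T := ht₀
  have ht₀0 : 0 < t₀ := by
    rcases ht₀.1.eq_or_lt with h | h
    · rw [← h] at hσ
      simp only [mul_zero, neg_zero, Real.exp_zero] at hσ
      linarith [h0 x₀ hx₀]
    · exact h
  obtain ⟨r₁, hr₁, hreg⟩ := hu.exists_regularization hΩo hΩb hΩ2 hm hf hcu hx₀ ht₀0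
  have hbd : ∀ᶠ X : Euc N × ℝ in 𝓝 (x₀, t₀), X.1 ∈ frontier Ω → -g X.1 < w X.1 X.2 := by
    by_cases hfr : x₀ ∈ frontier Ω
    · have hug := hu.le_boundary hΩb hΩ2 hm hlam hf hg hcu x₀ hfr t₀ ht₀0
      have hMe : 0 ≤ M₀ * Real.exp (-(lam * t₀)) := by positivity
      have h1 : ContinuousWithinAt (fun X : Euc N × ℝ => w X.1 X.2 + g X.1)
          (frontier Ω ×ˢ Ici 0) (x₀, t₀) := by
        refine ((hcw.mono (prod_mono_left frontier_subset_closure)) (x₀, t₀)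
          ⟨hfr, ht₀0.le⟩).add ?_
        exact (hg x₀ hfr).comp continuous_fst.continuousWithinAt fun X hX => hX.1
      have h2 := h1.eventually (lt_mem_nhds (a := 0) (by simp only; linarith))
      rw [eventually_nhdsWithin_iff] at h2
      filter_upwards [h2, (continuous_snd.tendsto (x₀, t₀)).eventually (lt_mem_nhds ht₀0)]
        with X hX hX' hfr
      linarith [hX ⟨hfr, le_of_lt hX'⟩]
    · have : ∀ᶠ X : Euc N × ℝ in 𝓝 (x₀, t₀), X.1 ∈ (frontier Ω)ᶜ :=
        (continuous_fst.tendsto (x₀, t₀)).eventually (isClosed_frontier.isOpen_compl.mem_nhds hfr)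
      filter_upwards [this] with X hX hX'
      exact absurd hX' hX
  obtain ⟨r₂, hr₂, hbd⟩ := ContinuousAt.exists_closedBall hbd
  set r := min (min r₁ r₂) (t₀ / 2) with hr
  have hr0 : 0 < r := by positivity
  have hrr₁ : r ≤ r₁ := (min_le_left _ _).trans (min_le_left _ _)
  have hrr₂ : r ≤ r₂ := (min_le_left _ _).trans (min_le_right _ _)
  have hrt : r ≤ t₀ / 2 := min_le_right _ _
  replace hbd : ∀ x t, ‖x - x₀‖ ≤ r → t ∈ Icc (t₀ - r) t₀ → x ∈ frontier Ω → -g x < w x t := by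
    intro x t hx ht
    refine hbd (x, t) ?_
    rw [mem_closedBall, Prod.dist_eq, max_le_iff]
    refine ⟨by simpa [dist_eq_norm] using hx.trans hrr₂, ?_⟩
    rw [Real.dist_eq, abs_le]
    constructor <;> linarith [ht.1, ht.2]
  obtain ⟨F, hF0, hF⟩ := hf.exists_abs_le_of_isCompact hΩb.isCompact_closure
  obtain ⟨M, hM0, hM⟩ := (hcu.mono hsub).exists_abs_le_of_isCompact hK
  replace hM : ∀ x ∈ closure Ω, ∀ t ∈ Icc 0 T, |u x t| ≤ M := fun x hx t ht => hM (x, t) ⟨hx, ht⟩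
  set A := (2 * M + 2) / r ^ 2 with hA
  have hA0 : 0 < A := by positivity
  have hAr : A * r ^ 2 = 2 * M + 2 := by rw [hA]; field_simp
  set B := 2 * A * r + 2 * A * N + (2 * A * r) ^ m with hB
  have hB0 : 0 ≤ B := by positivity
  set κ := min (1 / 2) (lam * σ / (4 * (lam * M + F + B))) with hκ
  have hκ0 : 0 < κ := by positivity
  have hκ1 : κ ≤ 1 / 2 := min_le_left _ _
  have hκ2 : κ * (lam * M + F + B) ≤ lam * σ / 4 := by
    have : κ ≤ lam * σ / (4 * (lam * M + F + B)) := min_le_right _ _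
    rw [le_div_iff₀ (by positivity)] at this
    linarith
  set ω := min (κ / 2) (lam * σ / (4 * (lam + 1))) with hω
  have hω0 : 0 < ω := by positivity
  have hω1 : ω ≤ κ / 2 := min_le_left _ _
  have hω2 : ω * (lam + 1) ≤ lam * σ / 4 := by
    have : ω ≤ lam * σ / (4 * (lam + 1)) := min_le_right _ _
    rw [le_div_iff₀ (by positivity)] at this
    linarith
  obtain ⟨U, hUc, hU⟩ := hreg ω hω0
  have hcpt : IsCompact ((closure Ω ∩ closedBall x₀ r) ×ˢ Icc (t₀ - r) t₀) :=
    (hΩb.isCompact_closure.inter_right isClosed_closedBall).prod isCompact_Icc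
  have hmem : (x₀, t₀) ∈ (closure Ω ∩ closedBall x₀ r) ×ˢ Icc (t₀ - r) t₀ :=
    ⟨⟨hx₀, mem_closedBall_self hr0.le⟩, by linarith, le_rfl⟩
  have hcont : ContinuousOn (fun X : Euc N × ℝ => w X.1 X.2 -
      ((-(1 - κ)) * U X + (κ * A) * (‖X.1 - x₀‖ ^ 2 + (X.2 - t₀) ^ 2)
        + M₀ * Real.exp (-(lam * X.2)))) ((closure Ω ∩ closedBall x₀ r) ×ˢ Icc (t₀ - r) t₀) := by
    refine (hcw.mono fun X hX => ⟨hX.1.1, ?_⟩).sub (Continuous.continuousOn ?_)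
    · exact le_trans (by linarith) hX.2.1
    · fun_prop
  obtain ⟨⟨x, t⟩, hX, hXmax⟩ := hcpt.exists_isMaxOn ⟨_, hmem⟩ hcont
  have hxr : ‖x - x₀‖ ≤ r := by simpa [dist_eq_norm] using hX.1.2
  have hxcl : x ∈ closure Ω := hX.1.1
  have htr : t ∈ Icc (t₀ - r) t₀ := hX.2
  have htT : t ∈ Icc 0 T := ⟨by linarith [htr.1], htr.2.trans ht₀.2⟩
  obtain ⟨hUu, a, p, l, hj, hineq⟩ := hU x hxcl (hxr.trans hrr₁) t ⟨by linarith [htr.1], htr.2⟩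
  have hUu₀ := (hU x₀ hx₀ (by simpa using hr₁.le) t₀ ⟨by linarith, le_rfl⟩).1
  have hu₁ := abs_le.1 (hM x hxcl t htT)
  have hu₂ := abs_le.1 (hM x₀ hx₀ t₀ ht₀)
  have hσx := hmax x hxcl t htT
  have hle := hXmax hmem
  simp only [mem_ofPred_eq, sub_self, norm_zero] at hle
  have hθU₀ : u x₀ t₀ - κ * M - ω ≤ (1 - κ) * U (x₀, t₀) := by
    have e1 := mul_le_mul_of_nonneg_left (show u x₀ t₀ - ω ≤ U (x₀, t₀) by
      linarith [(abs_le.1 hUu₀).1]) (show 0 ≤ 1 - κ by linarith)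
    have e2 := mul_le_mul_of_nonneg_left hu₂.2 hκ0.le
    have e3 : 0 < κ * ω := by positivity
    linarith
  have hθU : (1 - κ) * U (x, t) ≤ u x t + κ * M + ω := by
    have e1 := mul_le_mul_of_nonneg_left (show U (x, t) ≤ u x t + ω by
      linarith [(abs_le.1 hUu).2]) (show 0 ≤ 1 - κ by linarith)
    have e2 := mul_le_mul_of_nonneg_left hu₁.1 hκ0.le
    have e3 : 0 < κ * ω := by positivity
    linarith
  set d := ‖x - x₀‖ ^ 2 + (t - t₀) ^ 2 with hd
  have hd0 : 0 ≤ d := by positivity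
  have hd' : A * d ≤ 2 * M + 1 := by
    have : κ * (A * d) ≤ κ * (2 * M + 1) := by
      norm_num at hle
      linarith
    exact le_of_mul_le_mul_left this hκ0
  have hsmall : d < r ^ 2 := by
    by_contra! h
    have := mul_le_mul_of_nonneg_left h hA0.le
    linarith
  have hxr' : ‖x - x₀‖ < r := lt_of_pow_lt_pow_left₀ 2 hr0.le (by linarith [sq_nonneg (t - t₀)])
  have htr' : t₀ - r < t := by
    have : |t - t₀| < r := abs_lt_of_sq_lt_sq (by linarith [sq_nonneg ‖x - x₀‖]) hr0.le
    linarith [(abs_lt.1 this).1]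
  have hjet := ((hj.const_mul (-(1 - κ))).add
    ((hasJet_sq_norm_sub_add_sq x₀ x t₀ t).const_mul (κ * A))).add (hasJet_exp x t M₀ lam)
  rcases hw x hxcl t (by linarith) _ _ _ _ hjet
    (isLocalMaxOn_of_isMaxOn_cylinder hXmax hxr' htr' htr.2) with h | h
  · have hnorm : ‖(-(1 - κ)) • p + (κ * A) • (2 : ℝ) • (x - x₀) + 0‖ ^ m ≤
        (1 - κ) * ‖p‖ ^ m + κ * (2 * A * r) ^ m := by
      have e : (-(1 - κ)) • p + (κ * A) • (2 : ℝ) • (x - x₀) + 0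
          = -((1 - κ) • p + (1 - (1 - κ)) • (-(2 * A)) • (x - x₀)) := by
        module
      rw [e, norm_neg]
      refine (rpow_norm_convex hm (by linarith) (by linarith) p _).trans ?_
      have e2 : ‖(-(2 * A)) • (x - x₀)‖ ≤ 2 * A * r := by
        rw [norm_smul, norm_neg, Real.norm_of_nonneg (by positivity)]
        exact mul_le_mul_of_nonneg_left hxr (by positivity)
      have e3 := Real.rpow_le_rpow (norm_nonneg _) e2 (by linarith : 0 ≤ m)
      rw [sub_sub_cancel]
      exact add_le_add_right (mul_le_mul_of_nonneg_left e3 hκ0.le) _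
    have h1 := mul_le_mul_of_nonneg_left hineq (show 0 ≤ 1 - κ by linarith)
    have h2 : lam * (σ - κ * M - ω) ≤
        lam * ((1 - κ) * U (x, t) + w x t - M₀ * Real.exp (-(lam * t))) := by
      refine mul_le_mul_of_nonneg_left ?_ hlam.le
      have : 0 ≤ κ * A * d := by positivity
      norm_num at hle
      linarith
    have h3 : -(κ * A * r) ≤ κ * A * (t - t₀) := by
      have := mul_le_mul_of_nonneg_left (show -r ≤ t - t₀ by linarith) (by positivity : 0 ≤ κ * A)
      linarith
    have h4 : -(κ * F) ≤ κ * f x := by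
      have := mul_le_mul_of_nonneg_left (neg_le_of_abs_le (hF x hxcl)) hκ0.le
      linarith
    have h5 : 0 < κ * ω := by positivity
    have h6 : 0 < lam * σ := by positivity
    rw [hB] at hκ2
    linarith
  · exact absurd h.2 (not_le.2 (hbd x t hxr htr h.1))

end Comparison

section LongTime

variable {N : ℕ}

/-- The uniform limit as `t → ∞` of a parabolic subsolution is a stationary subsolution. -/
theorem VisSub.stationary_limit {σ : ℝ} {Ω : Set (Euc N)} (hΩb : Bornology.IsBounded Ω)
    {f g : Euc N → ℝ} {lam m : ℝ} (hm : 1 < m) (hf : ContinuousOn f (closure Ω))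
    (hg : ContinuousOn g (frontier Ω)) {u : Euc N → ℝ → ℝ} (hu : VisSub σ Ω f g lam m u)
    (hc : ContinuousOn (fun X : Euc N × ℝ => u X.1 X.2) (closure Ω ×ˢ Ici 0)) {u₁ : Euc N → ℝ}
    (hc₁ : ContinuousOn u₁ (closure Ω))
    (hlim : TendstoUniformlyOn (fun t x => u x t) u₁ atTop (closure Ω))
    {φ : Euc N → ℝ} (hφ : ContDiff ℝ 2 φ) {x₀ : Euc N} (hx₀ : x₀ ∈ closure Ω)
    (hmax : IsLocalMaxOn (u₁ - φ) (closure Ω) x₀) :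
    -lapl φ x₀ + σ * ‖gradient φ x₀‖ ^ m + lam * u₁ x₀ ≤ f x₀ ∨
      (x₀ ∈ frontier Ω ∧ u₁ x₀ ≤ g x₀) := by
  set ψ : Euc N → ℝ := fun y => φ y + (‖y - x₀‖ ^ 2) ^ 2 with hψdef
  have hψ : ContDiff ℝ 2 ψ := hφ.add (contDiff_norm_sub_pow_four x₀)
  have hψg : gradient ψ x₀ = gradient φ x₀ := by
    rw [hψdef, gradient_add' (hφ.differentiable (by norm_num) x₀)
      ((contDiff_norm_sub_pow_four x₀).differentiable (by norm_num) x₀),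
      gradient_norm_sub_pow_four]
    simp
  have hψl : lapl ψ x₀ = lapl φ x₀ := by
    rw [hψdef, lapl_add hφ.contDiffAt (contDiff_norm_sub_pow_four x₀).contDiffAt,
      lapl_norm_sub_pow_four]
    simp
  have key : ∀ ε > 0, ∃ x ∈ closure Ω, ∃ t τ, ‖x - x₀‖ ≤ ε ∧ |τ| ≤ ε ∧ |u x t - u₁ x₀| ≤ ε ∧
      (2 * τ - lapl ψ x + σ * ‖gradient ψ x‖ ^ m + lam * u x t ≤ f x ∨
        (x ∈ frontier Ω ∧ u x t ≤ g x)) := by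
    intro ε hε
    have h1 : ∀ᶠ x in 𝓝 x₀, x ∈ closure Ω →
        u₁ x - φ x ≤ u₁ x₀ - φ x₀ ∧ |u₁ x - u₁ x₀| < ε / 2 := by
      refine eventually_nhdsWithin_iff.1 (Filter.Eventually.and hmax ?_)
      have := (hc₁ x₀ hx₀).eventually (Metric.ball_mem_nhds _ (half_pos hε))
      simpa [Real.dist_eq] using this
    obtain ⟨r₁, hr₁, hball⟩ := Metric.nhds_basis_closedBall.eventually_iff.1 h1
    set r := min r₁ (min ε 1) with hr
    have hr0 : 0 < r := by positivity
    have hrr₁ : r ≤ r₁ := min_le_left _ _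
    have hrε : r ≤ ε := (min_le_right _ _).trans (min_le_left _ _)
    have hr1 : r ≤ 1 := (min_le_right _ _).trans (min_le_right _ _)
    set η := min (ε / 2) (r ^ 4 / 4) with hη
    have hη0 : 0 < η := by positivity
    have hηε : η ≤ ε / 2 := min_le_left _ _
    have hηr : η ≤ r ^ 4 / 4 := min_le_right _ _
    obtain ⟨S, hS⟩ := eventually_atTop.1 (Metric.tendstoUniformlyOn_iff.1 hlim η hη0)
    set s := max S 0 + 2 with hs
    have hsS : S + 2 ≤ s := by linarith [le_max_left S 0]
    have hs0 : 2 ≤ s := by linarith [le_max_right S 0]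
    have happrox : ∀ x ∈ closure Ω, ∀ t ∈ Icc (s - r) s, |u x t - u₁ x| ≤ η := by
      intro x hx t ht
      have := hS t (by linarith [ht.1]) x hx
      rw [dist_comm, Real.dist_eq] at this
      exact this.le
    have hcpt : IsCompact ((closure Ω ∩ closedBall x₀ r) ×ˢ Icc (s - r) s) :=
      (hΩb.isCompact_closure.inter_right isClosed_closedBall).prod isCompact_Icc
    have hmem : (x₀, s) ∈ (closure Ω ∩ closedBall x₀ r) ×ˢ Icc (s - r) s :=
      ⟨⟨hx₀, mem_closedBall_self hr0.le⟩, by linarith, le_rfl⟩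
    have hcont : ContinuousOn (fun X : Euc N × ℝ => u X.1 X.2 - (ψ X.1 + (X.2 - s) ^ 2))
        ((closure Ω ∩ closedBall x₀ r) ×ˢ Icc (s - r) s) := by
      refine (hc.mono fun X hX => ⟨hX.1.1, ?_⟩).sub (Continuous.continuousOn ?_)
      · exact le_trans (by linarith) hX.2.1
      · have := hψ.continuous
        fun_prop
    obtain ⟨⟨x, t⟩, hX, hXmax⟩ := hcpt.exists_isMaxOn ⟨_, hmem⟩ hcont
    have hxr : ‖x - x₀‖ ≤ r := by simpa [dist_eq_norm] using hX.1.2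
    have hxcl : x ∈ closure Ω := hX.1.1
    have htr : t ∈ Icc (s - r) s := hX.2
    obtain ⟨h2, h3⟩ := hball (x := x) (by rw [mem_closedBall, dist_eq_norm]; linarith) hxcl
    have ha := abs_le.1 (happrox x hxcl t htr)
    have ha₀ := abs_le.1 (happrox x₀ hx₀ s ⟨by linarith, le_rfl⟩)
    have hle := hXmax hmem
    simp only [hψdef, mem_ofPred_eq, sub_self, norm_zero] at hle
    norm_num at hle
    have hsum : (‖x - x₀‖ ^ 2) ^ 2 + (t - s) ^ 2 ≤ r ^ 4 / 2 := by linarith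
    have hr4 : 0 < r ^ 4 := by positivity
    have hxr' : ‖x - x₀‖ < r := by
      refine lt_of_pow_lt_pow_left₀ 4 hr0.le ?_
      have : ‖x - x₀‖ ^ 4 = (‖x - x₀‖ ^ 2) ^ 2 := by ring
      rw [this]
      linarith [sq_nonneg (t - s)]
    have htr' : |t - s| < r := by
      refine abs_lt_of_sq_lt_sq ?_ hr0.le
      have : r ^ 4 ≤ r ^ 2 := pow_le_pow_of_le_one hr0.le hr1 (by norm_num)
      linarith [sq_nonneg (‖x - x₀‖ ^ 2)]
    have ht0 := (abs_lt.1 htr').1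
    refine ⟨x, hxcl, t, t - s, hxr.trans hrε, htr'.le.trans hrε, ?_, ?_⟩
    · have := abs_lt.1 h3
      rw [abs_le]
      constructor <;> linarith
    · have hj := (HasJet.of_fst (t := t) (hψ.contDiffAt (x := x))).add
        (HasJet.of_snd (x := x) (t := t) (θ := fun τ => (τ - s) ^ 2)
          (ContDiff.contDiffAt (by fun_prop)))
      have hd : deriv (fun τ => (τ - s) ^ 2) t = 2 * (t - s) := by simp
      rw [hd] at hj
      have := hu x hxcl t (by linarith) _ _ _ _ hj
        (isLocalMaxOn_of_isMaxOn_cylinder hXmax hxr' (by linarith) htr.2)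
      simpa using this
  choose X hXcl T τ h1 h2 h3 h4 using fun n : ℕ => key (1 / ((n : ℝ) + 1)) (by positivity)
  have hε := tendsto_one_div_add_atTop_nhds_zero_nat (𝕜 := ℝ)
  have hX : Tendsto X atTop (𝓝 x₀) := tendsto_iff_norm_sub_tendsto_zero.2
    (squeeze_zero (fun _ => norm_nonneg _) h1 hε)
  have hτ : Tendsto τ atTop (𝓝 0) := squeeze_zero_norm h2 hε
  have hU : Tendsto (fun n => u (X n) (T n)) atTop (𝓝 (u₁ x₀)) :=
    tendsto_iff_norm_sub_tendsto_zero.2 (squeeze_zero (fun _ => norm_nonneg _) h3 hε)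
  have hfX : Tendsto (fun n => f (X n)) atTop (𝓝 (f x₀)) :=
    (hf x₀ hx₀).tendsto.comp (tendsto_nhdsWithin_iff.2 ⟨hX, Eventually.of_forall hXcl⟩)
  by_cases hfreq : ∃ᶠ n in atTop, 2 * τ n - lapl ψ (X n) + σ * ‖gradient ψ (X n)‖ ^ m +
      lam * u (X n) (T n) ≤ f (X n)
  · left
    have hL : Tendsto (fun n => 2 * τ n - lapl ψ (X n) + σ * ‖gradient ψ (X n)‖ ^ m +
        lam * u (X n) (T n)) atTop
        (𝓝 (2 * 0 - lapl ψ x₀ + σ * ‖gradient ψ x₀‖ ^ m + lam * u₁ x₀)) := by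
      refine (((hτ.const_mul 2).sub ((hψ.continuous_lapl.tendsto x₀).comp hX)).add
        (Tendsto.const_mul σ ?_)).add (hU.const_mul lam)
      exact (((hψ.continuous_gradient.tendsto x₀).comp hX).norm).rpow_const
        (Or.inr (by linarith))
    have := le_of_tendsto_of_tendsto_of_frequently hL hfX hfreq
    rw [hψg, hψl] at this
    linarith
  · right
    rw [not_frequently] at hfreq
    have hright : ∀ᶠ n in atTop, X n ∈ frontier Ω ∧ u (X n) (T n) ≤ g (X n) := by
      filter_upwards [hfreq] with n hn
      exact (h4 n).resolve_left hn
    have hfr : x₀ ∈ frontier Ω :=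
      isClosed_frontier.mem_of_tendsto hX (hright.mono fun n hn => hn.1)
    refine ⟨hfr, le_of_tendsto_of_tendsto hU ?_ (hright.mono fun n hn => hn.2)⟩
    exact (hg x₀ hfr).tendsto.comp
      (tendsto_nhdsWithin_iff.2 ⟨hX, hright.mono fun n hn => hn.1⟩)

theorem IsStatSub.le_of_isStatSuper {Ω : Set (Euc N)} (hΩo : IsOpen Ω)
    (hΩb : Bornology.IsBounded Ω) (hΩ2 : HasC2Boundary Ω) {f g : Euc N → ℝ} {lam m : ℝ}
    (hm : 1 < m) (hlam : 0 < lam) (hf : ContinuousOn f (closure Ω))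
    (hg : ContinuousOn g (frontier Ω)) {v w : Euc N → ℝ} (hcv : ContinuousOn v (closure Ω))
    (hcw : ContinuousOn w (closure Ω)) (hv : IsStatSub Ω f g lam m v)
    (hw : IsStatSuper Ω f g lam m w) : ∀ x ∈ closure Ω, v x ≤ w x := by
  intro x hx
  have hext : ∀ h : Euc N → ℝ, ContinuousOn h (closure Ω) →
      ContinuousOn (fun X : Euc N × ℝ => h X.1) (closure Ω ×ˢ Ici 0) := fun h hh =>
    hh.comp continuous_fst.continuousOn fun X hX => hX.1
  obtain ⟨M, hM0, hM⟩ := (hcv.add hcw.neg).exists_abs_le_of_isCompact hΩb.isCompact_closure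
  have hle := (hv.visSub hΩo).comparison hΩo hΩb hΩ2 hm hlam hf hg (hw.visSub hΩo)
    (hext v hcv) (hext (fun x => -w x) hcw.neg) hM0.le (fun y hy => le_of_abs_le (hM y hy)) x hx
  have hlim : Tendsto (fun t => M * Real.exp (-(lam * t))) atTop (𝓝 (M * 0)) :=
    (Real.tendsto_exp_neg_atTop_nhds_zero.comp (tendsto_id.const_mul_atTop hlam)).const_mul M
  have := ge_of_tendsto hlim ((eventually_ge_atTop 0).mono hle)
  linarith

end LongTime

section StationaryLimit

variable {N : ℕ}

theorem isStatSub_of_tendstoUniformlyOn {Ω : Set (Euc N)} (hΩo : IsOpen Ω)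
    (hΩb : Bornology.IsBounded Ω) {f g : Euc N → ℝ} {lam m : ℝ} (hm : 1 < m)
    (hf : ContinuousOn f (closure Ω)) (hg : ContinuousOn g (frontier Ω)) {u : Euc N → ℝ → ℝ}
    (hu : VisSub 1 Ω f g lam m u)
    (hc : ContinuousOn (fun X : Euc N × ℝ => u X.1 X.2) (closure Ω ×ˢ Ici 0)) {u₁ : Euc N → ℝ}
    (hc₁ : ContinuousOn u₁ (closure Ω))
    (hlim : TendstoUniformlyOn (fun t x => u x t) u₁ atTop (closure Ω)) :
    IsStatSub Ω f g lam m u₁ := by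
  refine ⟨hc₁.upperSemicontinuousOn, fun φ hφ x hx hmax => ?_⟩
  have h := hu.stationary_limit hΩb hm hf hg hc hc₁ hlim hφ hx hmax
  simp only [statOp]
  refine ⟨fun hx' => ?_, fun _ => min_le_iff.2 ?_⟩
  · rcases h with h | h
    · linarith
    · exact absurd hx' (hΩo.frontier_eq ▸ h.1).2
  · rcases h with h | h
    · exact Or.inl (by linarith)
    · exact Or.inr (by linarith [h.2])

theorem isStatSuper_of_tendstoUniformlyOn {Ω : Set (Euc N)} (hΩo : IsOpen Ω)
    (hΩb : Bornology.IsBounded Ω) {f g : Euc N → ℝ} {lam m : ℝ} (hm : 1 < m)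
    (hf : ContinuousOn f (closure Ω)) (hg : ContinuousOn g (frontier Ω)) {u : Euc N → ℝ → ℝ}
    (hu : VisSub (-1) Ω (fun x => - f x) (fun x => - g x) lam m (fun x t => - u x t))
    (hc : ContinuousOn (fun X : Euc N × ℝ => u X.1 X.2) (closure Ω ×ˢ Ici 0)) {u₁ : Euc N → ℝ}
    (hc₁ : ContinuousOn u₁ (closure Ω))
    (hlim : TendstoUniformlyOn (fun t x => u x t) u₁ atTop (closure Ω)) :
    IsStatSuper Ω f g lam m u₁ := by
  refine ⟨hc₁.lowerSemicontinuousOn, fun φ hφ x hx hmin => ?_⟩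
  have hlim' : TendstoUniformlyOn (fun t x => - u x t) (fun x => - u₁ x) atTop (closure Ω) := by
    rw [Metric.tendstoUniformlyOn_iff] at hlim ⊢
    simpa only [dist_neg_neg] using hlim
  have h := hu.stationary_limit hΩb hm hf.neg hg.neg hc.neg (u₁ := fun x => - u₁ x) hc₁.neg hlim'
    (contDiff_const.mul hφ : ContDiff ℝ 2 fun y => (-1) * φ y) hx (by
      filter_upwards [hmin] with y hy
      simp only [Pi.sub_apply] at hy ⊢
      linarith)
  rw [lapl_const_mul _ hφ.contDiffAt,
    gradient_const_mul' _ (hφ.differentiable (by norm_num) x), neg_one_smul, norm_neg] at h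
  simp only [Pi.neg_apply] at h
  simp only [statOp]
  refine ⟨fun hx' => ?_, fun _ => le_max_iff.2 ?_⟩
  · rcases h with h | h
    · linarith
    · exact absurd hx' (hΩo.frontier_eq ▸ h.1).2
  · rcases h with h | h
    · exact Or.inl (by linarith)
    · exact Or.inr (by linarith [h.2])

end StationaryLimit

/-- Long-time convergence in the discounted case `λ > 0`,
Theorem 4.1 (A) of the paper. -/
theorem stmt16 {N : ℕ} (hN : 1 ≤ N) (Ω : Set (Euc N))
    (hΩo : IsOpen Ω) (hΩb : Bornology.IsBounded Ω) (hΩc : IsConnected Ω)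
    (hΩ2 : HasC2Boundary Ω)
    (m lam : ℝ) (hm : 2 < m) (hlam : 0 < lam)
    (f u₀ g : Euc N → ℝ)
    (hf : ContinuousOn f (closure Ω)) (hu₀ : ContinuousOn u₀ (closure Ω))
    (hg : ContinuousOn g (frontier Ω))
    (hcomp : ∀ x ∈ frontier Ω, u₀ x = g x)
    (u : Euc N → ℝ → ℝ) (hu : IsGlobalParSol Ω f g u₀ lam m u) :
    (∃ C : ℝ, ∀ x ∈ closure Ω, ∀ t : ℝ, 0 ≤ t → |u x t| ≤ C) ∧
    ∃ u₁ : Euc N → ℝ, ContinuousOn u₁ (closure Ω) ∧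
      (∃ C : ℝ, ∀ x ∈ closure Ω, |u₁ x| ≤ C) ∧
      IsStatSub Ω f g lam m u₁ ∧ IsStatSuper Ω f g lam m u₁ ∧
      (∀ w : Euc N → ℝ, ContinuousOn w (closure Ω) →
        (∃ C : ℝ, ∀ x ∈ closure Ω, |w x| ≤ C) →
        IsStatSub Ω f g lam m w → IsStatSuper Ω f g lam m w →
        Set.EqOn w u₁ (closure Ω)) ∧
      TendstoUniformlyOn (fun t x => u x t) u₁ atTop (closure Ω) := by
  have hm1 : 1 < m := by linarith
  obtain ⟨hc, hsol⟩ := hu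
  have hsub : VisSub 1 Ω f g lam m u := IsParSub.visSub hΩo fun T hT => (hsol T hT).1
  have hsup := IsParSuper.visSub hΩo fun T hT => (hsol T hT).2
  have hinit : ∀ x ∈ closure Ω, u x 0 = u₀ x := fun x hx =>
    le_antisymm ((hsol 1 one_pos).1.2.1 x hx) ((hsol 1 one_pos).2.2.1 x hx)
  have hcpt := hΩb.isCompact_closure
  obtain ⟨C₁, hC₁, hC₁'⟩ := hu₀.exists_abs_le_of_isCompact hcpt
  obtain ⟨F, hF, hF'⟩ := hf.exists_abs_le_of_isCompact hcpt
  set C := max C₁ (F / lam) with hC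
  have hC0 : 0 < C := lt_max_of_lt_left hC₁
  have hFC : F ≤ lam * C := by
    have : F / lam ≤ C := le_max_right _ _
    rwa [div_le_iff₀' hlam] at this
  have hu₀C : ∀ x ∈ closure Ω, |u₀ x| ≤ C := fun x hx => (hC₁' x hx).trans (le_max_left _ _)
  have hgC : ∀ x ∈ frontier Ω, |g x| ≤ C := fun x hx =>
    hcomp x hx ▸ hu₀C x (frontier_subset_closure hx)
  have hbound : ∀ x ∈ closure Ω, ∀ t, 0 ≤ t → |u x t| ≤ C := by
    intro x hx t ht
    refine abs_le'.2 ⟨?_, ?_⟩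
    · exact hsub.le_of_initial_le hΩb hm1 hlam hc
        (fun y hy => hinit y hy ▸ le_of_abs_le (hu₀C y hy))
        (fun y hy => (le_of_abs_le (hF' y hy)).trans hFC)
        (fun y hy => le_of_abs_le (hgC y hy)) x hx t ht
    · exact hsup.le_of_initial_le hΩb hm1 hlam hc.neg
        (fun y hy => hinit y hy ▸ (neg_le_abs _).trans (hu₀C y hy))
        (fun y hy => (neg_le_abs _).trans ((hF' y hy).trans hFC))
        (fun y hy => (neg_le_abs _).trans (hgC y hy)) x hx t ht
  have hcontr : ∀ x ∈ closure Ω, ∀ s, 0 ≤ s → ∀ t, 0 ≤ t →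
      |u x (t + s) - u x t| ≤ 2 * C * Real.exp (-(lam * t)) := by
    intro x hx s hs t ht
    have hcs : ContinuousOn (fun X : Euc N × ℝ => u X.1 (X.2 + s)) (closure Ω ×ˢ Ici 0) :=
      hc.comp (f := fun X : Euc N × ℝ => (X.1, X.2 + s))
        (Continuous.continuousOn (by fun_prop)) fun X hX => ⟨hX.1, add_nonneg hX.2 hs⟩
    have hdiff : ∀ y ∈ closure Ω, |u y (0 + s)| ≤ C ∧ |u y 0| ≤ C := fun y hy =>
      ⟨hbound y hy _ (by linarith), hbound y hy 0 le_rfl⟩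
    have h1 := (hsub.shift hs).comparison hΩo hΩb hΩ2 hm1 hlam hf hg hsup hcs hc.neg
      (M₀ := 2 * C) (by positivity) (fun y hy => by
        linarith [le_of_abs_le (hdiff y hy).1, neg_le_of_abs_le (hdiff y hy).2]) x hx t ht
    have h2 := hsub.comparison hΩo hΩb hΩ2 hm1 hlam hf hg (hsup.shift hs) hc hcs.neg
      (M₀ := 2 * C) (by positivity) (fun y hy => by
        linarith [neg_le_of_abs_le (hdiff y hy).1, le_of_abs_le (hdiff y hy).2]) x hx t ht
    rw [abs_le]
    constructor <;> linarith
  have hexp : Tendsto (fun t => 2 * C * Real.exp (-(lam * t))) atTop (𝓝 0) := by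
    simpa using (Real.tendsto_exp_neg_atTop_nhds_zero.comp
      (tendsto_id.const_mul_atTop hlam)).const_mul (2 * C)
  have hexists : ∀ x, ∃ y, x ∈ closure Ω → Tendsto (fun n : ℕ => u x n) atTop (𝓝 y) := by
    intro x
    by_cases hx : x ∈ closure Ω
    · have : CauchySeq fun n : ℕ => u x n := by
        refine cauchySeq_of_le_tendsto_0' (fun n : ℕ => 2 * C * Real.exp (-(lam * n)))
          (fun n k hnk => ?_) (hexp.comp tendsto_natCast_atTop_atTop)
        rw [dist_comm, Real.dist_eq]
        have hnk' : (n : ℝ) ≤ k := by exact_mod_cast hnk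
        simpa using hcontr x hx (k - n) (by linarith) n (by positivity)
      obtain ⟨y, hy⟩ := cauchySeq_tendsto_of_complete this
      exact ⟨y, fun _ => hy⟩
    · exact ⟨0, fun h => absurd h hx⟩
  choose u₁ hu₁ using hexists
  have hrate : ∀ x ∈ closure Ω, ∀ t, 0 ≤ t → |u₁ x - u x t| ≤ 2 * C * Real.exp (-(lam * t)) := by
    intro x hx t ht
    refine le_of_tendsto ((hu₁ x hx).sub_const (u x t)).abs ?_
    filter_upwards [tendsto_natCast_atTop_atTop.eventually_ge_atTop t] with n hn
    simpa using hcontr x hx (n - t) (by linarith) t ht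
  have hlim : TendstoUniformlyOn (fun t x => u x t) u₁ atTop (closure Ω) := by
    rw [Metric.tendstoUniformlyOn_iff]
    intro ε hε
    filter_upwards [hexp.eventually (gt_mem_nhds hε), eventually_ge_atTop 0] with t ht ht0 x hx
    exact (hrate x hx t ht0).trans_lt ht
  have hc₁ : ContinuousOn u₁ (closure Ω) := by
    refine hlim.continuousOn (Eventually.frequently ?_)
    filter_upwards [eventually_ge_atTop 0] with t ht
    exact hc.comp (f := fun x : Euc N => (x, t)) (Continuous.continuousOn (by fun_prop))
      fun x hx => ⟨hx, ht⟩
  have hsub₁ := isStatSub_of_tendstoUniformlyOn hΩo hΩb hm1 hf hg hsub hc hc₁ hlim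
  have hsup₁ := isStatSuper_of_tendstoUniformlyOn hΩo hΩb hm1 hf hg hsup hc hc₁ hlim
  obtain ⟨C', -, hC'⟩ := hc₁.exists_abs_le_of_isCompact hcpt
  refine ⟨⟨C, hbound⟩, u₁, hc₁, ⟨C', hC'⟩, hsub₁, hsup₁, fun w hcw _ hw hw' x hx => ?_, hlim⟩
  exact le_antisymm
    (hw.le_of_isStatSuper hΩo hΩb hΩ2 hm1 hlam hf hg hcw hc₁ hsup₁ x hx)
    (hsub₁.le_of_isStatSuper hΩo hΩb hΩ2 hm1 hlam hf hg hc₁ hcw hw' x hx)
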